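/- arXiv:2602.10788 — 2 statements merged into one kernel-verified Lean document; each statement's English description precedes it below -/
import Mathlib

section
/- Let n, m, r, l ≥ 0 be integers and let P ∈ W be bihomogeneous of bidegree (n+r, m+r). Set Γ^{p,q} = (−1)^q · l! / (p! · q! · (n+r+p+1)! · (m+r+q+1)!) and define Ψ = Σ_{p+q=l, p,q≥0} Γ^{p,q} · ζ^p ζ̄^q · D_X^r D₁^n D̄₁^m P. Then Ψ lies in R (it contains no u, ū variables), and E_h Ψ = 0, F_v Ψ = 0, H_h Ψ = (n+m)·Ψ, H_v Ψ = (n+m+2r+2l+4)·Ψ. -/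
/-!
Context: the polynomial ring in the eight variables `y_i^α, ȳ_i^{α̇}` (indexed by
`Sum.inl`) together with the four auxiliary variables `u^α, ū^{α̇}` (indexed by
`Sum.inr`); R = ℂ[y,ȳ] sits inside it as the polynomials supported on `Sum.inl`,
and W = ℂ[u,ū] as those supported on `Sum.inr`.
-/

noncomputable section

open MvPolynomial

/-- Index type: `inl (inl (i,α)) ↔ y_i^α`, `inl (inr (i,α̇)) ↔ ȳ_i^{α̇}`,
`inr (inl α) ↔ u^α`, `inr (inr α̇) ↔ ū^{α̇}`. -/
abbrev Idx12 : Type := ((Fin 2 × Fin 2) ⊕ (Fin 2 × Fin 2)) ⊕ (Fin 2 ⊕ Fin 2)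

abbrev R12 : Type := MvPolynomial Idx12 ℂ

def yv (i a : Fin 2) : R12 := X (Sum.inl (Sum.inl (i, a)))
def ybv (i a : Fin 2) : R12 := X (Sum.inl (Sum.inr (i, a)))
def uv (a : Fin 2) : R12 := X (Sum.inr (Sum.inl a))
def ubv (a : Fin 2) : R12 := X (Sum.inr (Sum.inr a))

def dy (i a : Fin 2) : Module.End ℂ R12 := (pderiv (Sum.inl (Sum.inl (i, a)))).toLinearMap
def dyb (i a : Fin 2) : Module.End ℂ R12 := (pderiv (Sum.inl (Sum.inr (i, a)))).toLinearMap
def du (a : Fin 2) : Module.End ℂ R12 := (pderiv (Sum.inr (Sum.inl a))).toLinearMap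
def dub (a : Fin 2) : Module.End ℂ R12 := (pderiv (Sum.inr (Sum.inr a))).toLinearMap

/-- Multiplication by a polynomial. -/
def mulOp (p : R12) : Module.End ℂ R12 := LinearMap.mulLeft ℂ p

/-- `ζ = y₁¹y₂² − y₁²y₂¹`. -/
def zeta : R12 := yv 0 0 * yv 1 1 - yv 0 1 * yv 1 0

/-- `ζ̄ = ȳ₁¹ȳ₂² − ȳ₁²ȳ₂¹`. -/
def zetab : R12 := ybv 0 0 * ybv 1 1 - ybv 0 1 * ybv 1 0

/-- `X^{αα̇} = y₁^α ȳ₂^{α̇} − y₂^α ȳ₁^{α̇}`. -/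
def Xb (a ad : Fin 2) : R12 := yv 0 a * ybv 1 ad - yv 1 a * ybv 0 ad

/-- `D₁ = Σ_α y₁^α ∂/∂u^α`. -/
def D1 : Module.End ℂ R12 := ∑ a, mulOp (yv 0 a) * du a

/-- `D₂ = Σ_α y₂^α ∂/∂u^α`. -/
def D2 : Module.End ℂ R12 := ∑ a, mulOp (yv 1 a) * du a

/-- `D̄₁ = Σ_{α̇} ȳ₁^{α̇} ∂/∂ū^{α̇}`. -/
def Db1 : Module.End ℂ R12 := ∑ a, mulOp (ybv 0 a) * dub a

/-- `D̄₂ = Σ_{α̇} ȳ₂^{α̇} ∂/∂ū^{α̇}`. -/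
def Db2 : Module.End ℂ R12 := ∑ a, mulOp (ybv 1 a) * dub a

/-- `D_X = Σ_{α,α̇} X^{αα̇} ∂²/∂u^α∂ū^{α̇}`. -/
def DX : Module.End ℂ R12 := ∑ a, ∑ ad, mulOp (Xb a ad) * (du a * dub ad)

/-- Weight function counting the degree in `(u¹,u²)`. -/
def wtU : Idx12 → ℕ := fun j => match j with
  | Sum.inr (Sum.inl _) => 1
  | _ => 0

/-- Weight function counting the degree in `(ū¹,ū²)`. -/
def wtUb : Idx12 → ℕ := fun j => match j with
  | Sum.inr (Sum.inr _) => 1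
  | _ => 0

/-- `P` lies in `W = ℂ[u¹,u²,ū¹,ū²]` and is bihomogeneous of bidegree `(a,b)`. -/
def BihomW (a b : ℕ) (P : R12) : Prop :=
  P ∈ MvPolynomial.supported ℂ (Set.range Sum.inr) ∧
    P.IsWeightedHomogeneous wtU a ∧ P.IsWeightedHomogeneous wtUb b

/-- `E_h = Σ_α y₁^α ∂_{2α} + Σ_{α̇} ȳ₁^{α̇} ∂̄_{2α̇}`. -/
def Eh : Module.End ℂ R12 :=
  (∑ a, mulOp (yv 0 a) * dy 1 a) + (∑ a, mulOp (ybv 0 a) * dyb 1 a)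

/-- `F_v = (∂_{21}∂_{12} − ∂_{22}∂_{11}) + (∂̄_{21}∂̄_{12} − ∂̄_{22}∂̄_{11})`. -/
def Fv : Module.End ℂ R12 :=
  (dy 1 0 * dy 0 1 - dy 1 1 * dy 0 0) + (dyb 1 0 * dyb 0 1 - dyb 1 1 * dyb 0 0)

/-- `H_h = Σ_α (y₁^α ∂_{1α} − y₂^α ∂_{2α}) + Σ_{α̇} (ȳ₁^{α̇} ∂̄_{1α̇} − ȳ₂^{α̇} ∂̄_{2α̇})`. -/
def Hh : Module.End ℂ R12 :=
  (∑ a, (mulOp (yv 0 a) * dy 0 a - mulOp (yv 1 a) * dy 1 a)) +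
    (∑ a, (mulOp (ybv 0 a) * dyb 0 a - mulOp (ybv 1 a) * dyb 1 a))

/-- `H_v = Σ_{i,α} y_i^α ∂_{iα} + Σ_{i,α̇} ȳ_i^{α̇} ∂̄_{iα̇} + 4·id`. -/
def Hv : Module.End ℂ R12 :=
  (∑ i, ∑ a, mulOp (yv i a) * dy i a) + (∑ i, ∑ a, mulOp (ybv i a) * dyb i a) +
    (4 : ℂ) • (1 : Module.End ℂ R12)

/-- The coefficient `Γ^{p,q} = (−1)^q l! / (p! q! (n+r+p+1)! (m+r+q+1)!)`. -/
def Gam (n m r l p q : ℕ) : ℂ :=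
  ((-1 : ℂ) ^ q * (Nat.factorial l : ℂ)) /
    ((Nat.factorial p : ℂ) * (Nat.factorial q : ℂ) *
      (Nat.factorial (n + r + p + 1) : ℂ) * (Nat.factorial (m + r + q + 1) : ℂ))

/-- `Ψ = Σ_{p+q=l} Γ^{p,q} ζ^p ζ̄^q · D_X^r D₁^n D̄₁^m P`. -/
def Psi9 (n m r l : ℕ) (P : R12) : R12 :=
  ∑ p ∈ Finset.range (l + 1),
    Gam n m r l p (l - p) •
      (zeta ^ p * zetab ^ (l - p) * ((DX ^ r) ((D1 ^ n) ((Db1 ^ m) P))))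

/-! ### Pointwise rules for the elementary operators -/

set_option linter.unusedSimpArgs false
set_option linter.flexible false

lemma pderiv_swap (i j : Idx12) (f : R12) : pderiv i (pderiv j f) = pderiv j (pderiv i f) := by
  have h : ⁅(pderiv i : Derivation ℂ R12 R12), (pderiv j : Derivation ℂ R12 R12)⁆ = 0 := by
    apply MvPolynomial.derivation_ext
    intro k
    classical
    rw [Derivation.commutator_apply, pderiv_X, pderiv_X, Pi.single_apply, Pi.single_apply]
    split_ifs <;> simp
  have := congrArg (fun D : Derivation ℂ R12 R12 => D f) h
  rw [Derivation.commutator_apply] at this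
  exact sub_eq_zero.mp this

section rules
variable (i j a b : Fin 2) (f g : R12)

lemma mulOp_ap : mulOp f g = f * g := rfl
lemma dy_mul : dy i a (f * g) = dy i a f * g + f * dy i a g := pderiv_mul
lemma dyb_mul : dyb i a (f * g) = dyb i a f * g + f * dyb i a g := pderiv_mul
lemma du_mul : du a (f * g) = du a f * g + f * du a g := pderiv_mul
lemma dub_mul : dub a (f * g) = dub a f * g + f * dub a g := pderiv_mul
lemma dy_yv : dy i a (yv j b) = if i = j ∧ a = b then 1 else 0 := by
  simp [dy, yv, pderiv_X, Pi.single_apply, eq_comm]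
lemma dy_ybv : dy i a (ybv j b) = 0 := by simp [dy, ybv, pderiv_X, Pi.single_apply]
lemma dyb_yv : dyb i a (yv j b) = 0 := by simp [dyb, yv, pderiv_X, Pi.single_apply]
lemma dyb_ybv : dyb i a (ybv j b) = if i = j ∧ a = b then 1 else 0 := by
  simp [dyb, ybv, pderiv_X, Pi.single_apply, eq_comm]
lemma du_yv : du a (yv j b) = 0 := by simp [du, yv, pderiv_X, Pi.single_apply]
lemma du_ybv : du a (ybv j b) = 0 := by simp [du, ybv, pderiv_X, Pi.single_apply]
lemma dub_yv : dub a (yv j b) = 0 := by simp [dub, yv, pderiv_X, Pi.single_apply]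
lemma dub_ybv : dub a (ybv j b) = 0 := by simp [dub, ybv, pderiv_X, Pi.single_apply]
lemma du_dy : du a (dy i b f) = dy i b (du a f) := pderiv_swap _ _ _
lemma du_dyb : du a (dyb i b f) = dyb i b (du a f) := pderiv_swap _ _ _
lemma dub_dy : dub a (dy i b f) = dy i b (dub a f) := pderiv_swap _ _ _
lemma dub_dyb : dub a (dyb i b f) = dyb i b (dub a f) := pderiv_swap _ _ _
lemma dub_du : dub a (du b f) = du b (dub a f) := pderiv_swap _ _ _
lemma dyb_dy : dyb j a (dy i b f) = dy i b (dyb j a f) := pderiv_swap _ _ _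
lemma dy_dy1 : dy 1 a (dy 0 b f) = dy 0 b (dy 1 a f) := pderiv_swap _ _ _
lemma dy_dy2 : dy i 1 (dy i 0 f) = dy i 0 (dy i 1 f) := pderiv_swap _ _ _
lemma dyb_dyb1 : dyb 1 a (dyb 0 b f) = dyb 0 b (dyb 1 a f) := pderiv_swap _ _ _
lemma dyb_dyb2 : dyb i 1 (dyb i 0 f) = dyb i 0 (dyb i 1 f) := pderiv_swap _ _ _
lemma du_du : du 1 (du 0 f) = du 0 (du 1 f) := pderiv_swap _ _ _
lemma dub_dub : dub 1 (dub 0 f) = dub 0 (dub 1 f) := pderiv_swap _ _ _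

lemma D1_ap : D1 f = yv 0 0 * du 0 f + yv 0 1 * du 1 f := by
  simp [D1, Fin.sum_univ_two, mulOp_ap]
lemma D2_ap : D2 f = yv 1 0 * du 0 f + yv 1 1 * du 1 f := by
  simp [D2, Fin.sum_univ_two, mulOp_ap]
lemma Db1_ap : Db1 f = ybv 0 0 * dub 0 f + ybv 0 1 * dub 1 f := by
  simp [Db1, Fin.sum_univ_two, mulOp_ap]
lemma Db2_ap : Db2 f = ybv 1 0 * dub 0 f + ybv 1 1 * dub 1 f := by
  simp [Db2, Fin.sum_univ_two, mulOp_ap]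
/-- `D_X = D₁ D̄₂ - D₂ D̄₁`, written out. -/
lemma DX_ap : DX f = yv 0 0 * du 0 (Db2 f) + yv 0 1 * du 1 (Db2 f)
    - yv 1 0 * du 0 (Db1 f) - yv 1 1 * du 1 (Db1 f) := by
  simp only [DX, Fin.sum_univ_two, mulOp_ap, Xb, Db1_ap, Db2_ap, LinearMap.add_apply,
    Module.End.mul_apply, du_mul, du_ybv, map_add]
  ring
end rules

/-- Unbarred Euler operator. -/
def EU : Module.End ℂ R12 := ∑ i, ∑ a, mulOp (yv i a) * dy i a
/-- Barred Euler operator. -/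
def EUb : Module.End ℂ R12 := ∑ i, ∑ a, mulOp (ybv i a) * dyb i a
/-- Unbarred half of `F_v`. -/
def Fy : Module.End ℂ R12 := dy 1 0 * dy 0 1 - dy 1 1 * dy 0 0
/-- Barred half of `F_v`. -/
def Fyb : Module.End ℂ R12 := dyb 1 0 * dyb 0 1 - dyb 1 1 * dyb 0 0
/-- Mixed antisymmetrised derivatives. -/
def Gy (i : Fin 2) : Module.End ℂ R12 := dy i 1 * du 0 - dy i 0 * du 1
/-- Mixed antisymmetrised derivatives, barred. -/
def Gyb (i : Fin 2) : Module.End ℂ R12 := dyb i 1 * dub 0 - dyb i 0 * dub 1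

lemma Fv_ap (f : R12) : Fv f = Fy f + Fyb f := rfl
lemma Hv_ap (f : R12) : Hv f = EU f + EUb f + (4 : ℂ) • f := rfl
lemma Fy_ap (f : R12) : Fy f = dy 1 0 (dy 0 1 f) - dy 1 1 (dy 0 0 f) := rfl
lemma Fyb_ap (f : R12) : Fyb f = dyb 1 0 (dyb 0 1 f) - dyb 1 1 (dyb 0 0 f) := rfl
lemma Gy_ap (i : Fin 2) (f : R12) : Gy i f = dy i 1 (du 0 f) - dy i 0 (du 1 f) := rfl
lemma Gyb_ap (i : Fin 2) (f : R12) : Gyb i f = dyb i 1 (dub 0 f) - dyb i 0 (dub 1 f) := rfl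
lemma EU_ap (f : R12) : EU f = yv 0 0 * dy 0 0 f + yv 0 1 * dy 0 1 f
    + yv 1 0 * dy 1 0 f + yv 1 1 * dy 1 1 f := by
  simp [EU, Fin.sum_univ_two, mulOp_ap]; ring
lemma EUb_ap (f : R12) : EUb f = ybv 0 0 * dyb 0 0 f + ybv 0 1 * dyb 0 1 f
    + ybv 1 0 * dyb 1 0 f + ybv 1 1 * dyb 1 1 f := by
  simp [EUb, Fin.sum_univ_two, mulOp_ap]; ring
lemma Eh_ap (f : R12) : Eh f = yv 0 0 * dy 1 0 f + yv 0 1 * dy 1 1 f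
    + ybv 0 0 * dyb 1 0 f + ybv 0 1 * dyb 1 1 f := by
  simp [Eh, Fin.sum_univ_two, mulOp_ap]; ring
lemma Hh_ap (f : R12) : Hh f = yv 0 0 * dy 0 0 f + yv 0 1 * dy 0 1 f
    - yv 1 0 * dy 1 0 f - yv 1 1 * dy 1 1 f
    + ybv 0 0 * dyb 0 0 f + ybv 0 1 * dyb 0 1 f
    - ybv 1 0 * dyb 1 0 f - ybv 1 1 * dyb 1 1 f := by
  simp [Hh, Fin.sum_univ_two, mulOp_ap]; ring

/-! ### Commutation relations -/

set_option maxHeartbeats 4000000 in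
lemma D1_rel (f : R12) :
    Eh (D1 f) = D1 (Eh f) ∧
    Fy (D1 f) = D1 (Fy f) - Gy 1 f ∧
    Fyb (D1 f) = D1 (Fyb f) ∧
    Gy 0 (D1 f) = D1 (Gy 0 f) ∧
    Gy 1 (D1 f) = D1 (Gy 1 f) ∧
    Gyb 0 (D1 f) = D1 (Gyb 0 f) ∧
    Gyb 1 (D1 f) = D1 (Gyb 1 f) ∧
    EU (D1 f) = D1 (EU f) + D1 f ∧
    EUb (D1 f) = D1 (EUb f) ∧
    Hh (D1 f) = D1 (Hh f) + D1 f := by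
  refine ⟨?_, ?_, ?_, ?_, ?_, ?_, ?_, ?_, ?_, ?_⟩ <;>
  · simp only [zeta, zetab, Eh_ap, Fy_ap, Fyb_ap, Gy_ap, Gyb_ap, EU_ap, EUb_ap, Hh_ap, DX_ap, D1_ap,
      D2_ap, Db1_ap, Db2_ap, map_add, map_sub, dy_mul, dyb_mul, du_mul, dub_mul, dy_yv, dy_ybv,
      dyb_yv, dyb_ybv, du_yv, du_ybv, dub_yv, dub_ybv, du_dy, du_dyb, dub_dy, dub_dyb, dub_du,
      dyb_dy, dy_dy1, dy_dy2, dyb_dyb1, dyb_dyb2, du_du, dub_dub, zero_mul, one_mul, zero_add,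
      add_zero, zero_ne_one, one_ne_zero, and_true, and_false, true_and, false_and, if_true,
      if_false, and_self, map_zero, map_one]
    ring

set_option maxHeartbeats 4000000 in
lemma Db1_rel (f : R12) :
    Eh (Db1 f) = Db1 (Eh f) ∧
    Fy (Db1 f) = Db1 (Fy f) ∧
    Fyb (Db1 f) = Db1 (Fyb f) - Gyb 1 f ∧
    Gy 0 (Db1 f) = Db1 (Gy 0 f) ∧
    Gy 1 (Db1 f) = Db1 (Gy 1 f) ∧
    Gyb 0 (Db1 f) = Db1 (Gyb 0 f) ∧
    Gyb 1 (Db1 f) = Db1 (Gyb 1 f) ∧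
    EU (Db1 f) = Db1 (EU f) ∧
    EUb (Db1 f) = Db1 (EUb f) + Db1 f ∧
    Hh (Db1 f) = Db1 (Hh f) + Db1 f := by
  refine ⟨?_, ?_, ?_, ?_, ?_, ?_, ?_, ?_, ?_, ?_⟩ <;>
  · simp only [zeta, zetab, Eh_ap, Fy_ap, Fyb_ap, Gy_ap, Gyb_ap, EU_ap, EUb_ap, Hh_ap, DX_ap, D1_ap,
      D2_ap, Db1_ap, Db2_ap, map_add, map_sub, dy_mul, dyb_mul, du_mul, dub_mul, dy_yv, dy_ybv,
      dyb_yv, dyb_ybv, du_yv, du_ybv, dub_yv, dub_ybv, du_dy, du_dyb, dub_dy, dub_dyb, dub_du,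
      dyb_dy, dy_dy1, dy_dy2, dyb_dyb1, dyb_dyb2, du_du, dub_dub, zero_mul, one_mul, zero_add,
      add_zero, zero_ne_one, one_ne_zero, and_true, and_false, true_and, false_and, if_true,
      if_false, and_self, map_zero, map_one]
    ring

set_option maxHeartbeats 4000000 in
lemma DX_rel (f : R12) :
    Eh (DX f) = DX (Eh f) ∧
    Fy (DX f) = DX (Fy f) - Db2 (Gy 1 f) - Db1 (Gy 0 f) ∧
    Fyb (DX f) = DX (Fyb f) + D2 (Gyb 1 f) + D1 (Gyb 0 f) ∧
    Gy 0 (DX f) = DX (Gy 0 f) ∧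
    Gy 1 (DX f) = DX (Gy 1 f) ∧
    Gyb 0 (DX f) = DX (Gyb 0 f) ∧
    Gyb 1 (DX f) = DX (Gyb 1 f) ∧
    EU (DX f) = DX (EU f) + DX f ∧
    EUb (DX f) = DX (EUb f) + DX f ∧
    Hh (DX f) = DX (Hh f) := by
  refine ⟨?_, ?_, ?_, ?_, ?_, ?_, ?_, ?_, ?_, ?_⟩ <;>
  · simp only [zeta, zetab, Eh_ap, Fy_ap, Fyb_ap, Gy_ap, Gyb_ap, EU_ap, EUb_ap, Hh_ap, DX_ap, D1_ap,
      D2_ap, Db1_ap, Db2_ap, map_add, map_sub, dy_mul, dyb_mul, du_mul, dub_mul, dy_yv, dy_ybv,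
      dyb_yv, dyb_ybv, du_yv, du_ybv, dub_yv, dub_ybv, du_dy, du_dyb, dub_dy, dub_dyb, dub_du,
      dyb_dy, dy_dy1, dy_dy2, dyb_dyb1, dyb_dyb2, du_du, dub_dub, zero_mul, one_mul, zero_add,
      add_zero, zero_ne_one, one_ne_zero, and_true, and_false, true_and, false_and, if_true,
      if_false, and_self, map_zero, map_one]
    ring

set_option maxHeartbeats 4000000 in
lemma zeta_rel (f : R12) :
    Eh (zeta * f) = zeta * Eh f ∧
    Fy (zeta * f) = zeta * Fy f - EU f - 2 * f ∧
    Fyb (zeta * f) = zeta * Fyb f ∧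
    EU (zeta * f) = zeta * EU f + 2 * (zeta * f) ∧
    EUb (zeta * f) = zeta * EUb f ∧
    Hh (zeta * f) = zeta * Hh f := by
  refine ⟨?_, ?_, ?_, ?_, ?_, ?_⟩ <;>
  · simp only [zeta, zetab, Eh_ap, Fy_ap, Fyb_ap, Gy_ap, Gyb_ap, EU_ap, EUb_ap, Hh_ap, DX_ap, D1_ap,
      D2_ap, Db1_ap, Db2_ap, map_add, map_sub, dy_mul, dyb_mul, du_mul, dub_mul, dy_yv, dy_ybv,
      dyb_yv, dyb_ybv, du_yv, du_ybv, dub_yv, dub_ybv, du_dy, du_dyb, dub_dy, dub_dyb, dub_du,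
      dyb_dy, dy_dy1, dy_dy2, dyb_dyb1, dyb_dyb2, du_du, dub_dub, zero_mul, one_mul, zero_add,
      add_zero, zero_ne_one, one_ne_zero, and_true, and_false, true_and, false_and, if_true,
      if_false, and_self, map_zero, map_one]
    ring

set_option maxHeartbeats 4000000 in
lemma zetab_rel (f : R12) :
    Eh (zetab * f) = zetab * Eh f ∧
    Fy (zetab * f) = zetab * Fy f ∧
    Fyb (zetab * f) = zetab * Fyb f - EUb f - 2 * f ∧
    EU (zetab * f) = zetab * EU f ∧
    EUb (zetab * f) = zetab * EUb f + 2 * (zetab * f) ∧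
    Hh (zetab * f) = zetab * Hh f := by
  refine ⟨?_, ?_, ?_, ?_, ?_, ?_⟩ <;>
  · simp only [zeta, zetab, Eh_ap, Fy_ap, Fyb_ap, Gy_ap, Gyb_ap, EU_ap, EUb_ap, Hh_ap, DX_ap, D1_ap,
      D2_ap, Db1_ap, Db2_ap, map_add, map_sub, dy_mul, dyb_mul, du_mul, dub_mul, dy_yv, dy_ybv,
      dyb_yv, dyb_ybv, du_yv, du_ybv, dub_yv, dub_ybv, du_dy, du_dyb, dub_dy, dub_dyb, dub_du,
      dyb_dy, dy_dy1, dy_dy2, dyb_dyb1, dyb_dyb2, du_du, dub_dub, zero_mul, one_mul, zero_add,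
      add_zero, zero_ne_one, one_ne_zero, and_true, and_false, true_and, false_and, if_true,
      if_false, and_self, map_zero, map_one]
    ring

/-! ### The invariant -/

/-- Joint (highest-weight and degree) conditions preserved by `D₁`, `D̄₁`, `D_X`. -/
structure Good (a b c : ℕ) (f : R12) : Prop where
  eh : Eh f = 0
  fy : Fy f = 0
  fyb : Fyb f = 0
  g0 : Gy 0 f = 0
  g1 : Gy 1 f = 0
  gb0 : Gyb 0 f = 0
  gb1 : Gyb 1 f = 0
  eu : EU f = (a : ℂ) • f
  eub : EUb f = (b : ℂ) • f
  hh : Hh f = (c : ℂ) • f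

lemma Good.D1 {a b c : ℕ} {f : R12} (h : Good a b c f) : Good (a + 1) b (c + 1) (D1 f) := by
  obtain ⟨h1, h2, h3, h4, h5, h6, h7, h8, h9, h10⟩ := D1_rel f
  constructor <;>
    simp [h1, h2, h3, h4, h5, h6, h7, h8, h9, h10, h.eh, h.fy, h.fyb, h.g0, h.g1, h.gb0, h.gb1,
      h.eu, h.eub, h.hh, add_smul]

lemma Good.Db1 {a b c : ℕ} {f : R12} (h : Good a b c f) : Good a (b + 1) (c + 1) (Db1 f) := by
  obtain ⟨h1, h2, h3, h4, h5, h6, h7, h8, h9, h10⟩ := Db1_rel f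
  constructor <;>
    simp [h1, h2, h3, h4, h5, h6, h7, h8, h9, h10, h.eh, h.fy, h.fyb, h.g0, h.g1, h.gb0, h.gb1,
      h.eu, h.eub, h.hh, add_smul]

lemma Good.DX {a b c : ℕ} {f : R12} (h : Good a b c f) : Good (a + 1) (b + 1) c (DX f) := by
  obtain ⟨h1, h2, h3, h4, h5, h6, h7, h8, h9, h10⟩ := DX_rel f
  constructor <;>
    simp [h1, h2, h3, h4, h5, h6, h7, h8, h9, h10, h.eh, h.fy, h.fyb, h.g0, h.g1, h.gb0, h.gb1,
      h.eu, h.eub, h.hh, add_smul]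

lemma Good.base {P : R12} (hP : P ∈ MvPolynomial.supported ℂ (Set.range Sum.inr)) :
    Good 0 0 0 P := by
  have key : ∀ k, pderiv (Sum.inl k) P = 0 := fun k => by
    apply pderiv_eq_zero_of_notMem_vars
    intro hk
    obtain ⟨x, hx⟩ := mem_supported.mp hP hk
    cases hx
  have h1 : ∀ i a, dy i a P = 0 := fun i a => key _
  have h2 : ∀ i a, dyb i a P = 0 := fun i a => key _
  constructor <;> simp [Eh_ap, Fy_ap, Fyb_ap, Gy_ap, Gyb_ap, EU_ap, EUb_ap, Hh_ap, h1, h2,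
    ← du_dy, ← dub_dyb]

lemma good_all {P : R12} (hP : P ∈ MvPolynomial.supported ℂ (Set.range Sum.inr)) (n m r : ℕ) :
    Good (n + r) (m + r) (n + m) ((DX ^ r) ((D1 ^ n) ((Db1 ^ m) P))) := by
  have hm : Good 0 m m ((Db1 ^ m) P) := by
    induction m with
    | zero => exact Good.base hP
    | succ k ih => rw [pow_succ']; exact ih.Db1
  have hn : Good n m (n + m) ((D1 ^ n) ((Db1 ^ m) P)) := by
    induction n with
    | zero => simpa using hm
    | succ k ih => rw [pow_succ', Nat.add_right_comm]; exact ih.D1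
  induction r with
  | zero => exact hn
  | succ k ih => rw [pow_succ']; exact ih.DX

/-! ### Independence of `u`, `ū` -/

lemma wh_mul_X {w : Idx12 → ℕ} {k : ℕ} {f : R12} (j) (hw : w (Sum.inl j) = 0)
    (h : f.IsWeightedHomogeneous w k) : (X (Sum.inl j) * f).IsWeightedHomogeneous w k := by
  have := (isWeightedHomogeneous_X ℂ w (Sum.inl j)).mul h
  rwa [hw, zero_add] at this

/-- Bihomogeneity in `(u, ū)`. -/
def BH (a b : ℕ) (f : R12) : Prop :=
  f.IsWeightedHomogeneous wtU a ∧ f.IsWeightedHomogeneous wtUb b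

section
variable {a b : ℕ} {f g : R12}
lemma BH.add (h : BH a b f) (h' : BH a b g) : BH a b (f + g) := ⟨h.1.add h'.1, h.2.add h'.2⟩
lemma BH.sub (h : BH a b f) (h' : BH a b g) : BH a b (f - g) :=
  ⟨(weightedHomogeneousSubmodule ℂ wtU a).sub_mem h.1 h'.1,
    (weightedHomogeneousSubmodule ℂ wtUb b).sub_mem h.2 h'.2⟩
lemma BH.yv (i j) (h : BH a b f) : BH a b (yv i j * f) :=
  ⟨wh_mul_X _ rfl h.1, wh_mul_X _ rfl h.2⟩
lemma BH.ybv (i j) (h : BH a b f) : BH a b (ybv i j * f) :=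
  ⟨wh_mul_X _ rfl h.1, wh_mul_X _ rfl h.2⟩
lemma BH.du (i) (h : BH (a + 1) b f) : BH a b (du i f) :=
  ⟨IsWeightedHomogeneous.pderiv h.1 rfl, IsWeightedHomogeneous.pderiv h.2 rfl⟩
lemma BH.dub (i) (h : BH a (b + 1) f) : BH a b (dub i f) :=
  ⟨IsWeightedHomogeneous.pderiv h.1 rfl, IsWeightedHomogeneous.pderiv h.2 rfl⟩
lemma BH.D1 (h : BH (a + 1) b f) : BH a b (D1 f) := by
  rw [D1_ap]; exact ((h.du _).yv _ _).add ((h.du _).yv _ _)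
lemma BH.Db1 (h : BH a (b + 1) f) : BH a b (Db1 f) := by
  rw [Db1_ap]; exact ((h.dub _).ybv _ _).add ((h.dub _).ybv _ _)
lemma BH.Db2 (h : BH a (b + 1) f) : BH a b (Db2 f) := by
  rw [Db2_ap]; exact ((h.dub _).ybv _ _).add ((h.dub _).ybv _ _)
lemma BH.DX (h : BH (a + 1) (b + 1) f) : BH a b (DX f) := by
  rw [DX_ap]
  exact ((((h.Db2.du _).yv _ _).add ((h.Db2.du _).yv _ _)).sub ((h.Db1.du _).yv _ _)).sub
    ((h.Db1.du _).yv _ _)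
lemma BH.Db1_pow (m : ℕ) (h : BH a (b + m) f) : BH a b ((_root_.Db1 ^ m) f) := by
  induction m generalizing f with
  | zero => exact h
  | succ k ih => rw [pow_succ]; exact ih (BH.Db1 h)
lemma BH.D1_pow (m : ℕ) (h : BH (a + m) b f) : BH a b ((_root_.D1 ^ m) f) := by
  induction m generalizing f with
  | zero => exact h
  | succ k ih => rw [pow_succ]; exact ih (BH.D1 h)
lemma BH.DX_pow (m : ℕ) (h : BH (a + m) (b + m) f) : BH a b ((_root_.DX ^ m) f) := by
  induction m generalizing f with
  | zero => exact h
  | succ k ih => rw [pow_succ]; exact ih (BH.DX h)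

lemma BH.supp (h : BH 0 0 f) : f ∈ MvPolynomial.supported ℂ (Set.range Sum.inl) := by
  rw [mem_supported]
  intro j hj
  obtain ⟨d, hd, hjd⟩ := mem_vars_iff_mem_support j |>.mp hj
  have e1 := h.1 (mem_support_iff.mp hd)
  have e2 := h.2 (mem_support_iff.mp hd)
  rw [Finsupp.weight_apply, Finsupp.sum, Finset.sum_eq_zero_iff] at e1 e2
  have f1 := e1 j hjd
  have f2 := e2 j hjd
  have hne := Finsupp.mem_support_iff.mp hjd
  rcases j with j | j | j
  · exact ⟨j, rfl⟩
  · exact absurd (by simpa [wtU] using f1) hne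
  · exact absurd (by simpa [wtUb] using f2) hne
end

lemma zeta_supp : zeta ∈ MvPolynomial.supported ℂ (Set.range Sum.inl : Set Idx12) := by
  have h : ∀ i a, yv i a ∈ MvPolynomial.supported ℂ (Set.range Sum.inl : Set Idx12) :=
    fun i a => Algebra.subset_adjoin ⟨_, ⟨_, rfl⟩, rfl⟩
  exact sub_mem (mul_mem (h _ _) (h _ _)) (mul_mem (h _ _) (h _ _))

lemma zetab_supp : zetab ∈ MvPolynomial.supported ℂ (Set.range Sum.inl : Set Idx12) := by
  have h : ∀ i a, ybv i a ∈ MvPolynomial.supported ℂ (Set.range Sum.inl : Set Idx12) :=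
    fun i a => Algebra.subset_adjoin ⟨_, ⟨_, rfl⟩, rfl⟩
  exact sub_mem (mul_mem (h _ _) (h _ _)) (mul_mem (h _ _) (h _ _))

/-! ### Multiplication by powers of `ζ`, `ζ̄` -/

/-- The action of the operators on `ζ^p ζ̄^q Q`. -/
structure Good2 (a b c p q : ℕ) (Q f : R12) : Prop where
  eh : Eh f = 0
  fy : Fy f = -((p * (a + p + 1) : ℕ) : ℂ) • (zeta ^ (p - 1) * zetab ^ q * Q)
  fyb : Fyb f = -((q * (b + q + 1) : ℕ) : ℂ) • (zeta ^ p * zetab ^ (q - 1) * Q)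
  eu : EU f = ((a + 2 * p : ℕ) : ℂ) • f
  eub : EUb f = ((b + 2 * q : ℕ) : ℂ) • f
  hh : Hh f = (c : ℂ) • f

lemma C_two : (C 2 : R12) = 2 := map_ofNat C 2

lemma Good.two {a b c : ℕ} {Q : R12} (h : Good a b c Q) (p q : ℕ) :
    Good2 a b c p q Q (zeta ^ p * zetab ^ q * Q) := by
  induction p with
  | zero =>
    induction q with
    | zero =>
      constructor <;> simp [h.eh, h.fy, h.fyb, h.eu, h.eub, h.hh]
    | succ q ih =>
      obtain ⟨h1, h2, h3, h4, h5, h6⟩ := zetab_rel (zeta ^ 0 * zetab ^ q * Q)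
      have e : zeta ^ 0 * zetab ^ (q + 1) * Q = zetab * (zeta ^ 0 * zetab ^ q * Q) := by ring
      rw [e]
      constructor
      · rw [h1, ih.eh, mul_zero]
      · rw [h2, ih.fy]; simp
      · rw [h3, ih.fyb, ih.eub]
        rcases q with _ | q
        · simp [smul_eq_C_mul, C_two]; ring
        · simp [smul_eq_C_mul, C_two]; ring
      · rw [h4, ih.eu]; simp [smul_eq_C_mul, C_two]; ring
      · rw [h5, ih.eub]; simp [smul_eq_C_mul, C_two]; ring
      · rw [h6, ih.hh]; simp [smul_eq_C_mul, C_two]; ring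
  | succ p ih =>
    obtain ⟨h1, h2, h3, h4, h5, h6⟩ := zeta_rel (zeta ^ p * zetab ^ q * Q)
    have e : zeta ^ (p + 1) * zetab ^ q * Q = zeta * (zeta ^ p * zetab ^ q * Q) := by ring
    rw [e]
    constructor
    · rw [h1, ih.eh, mul_zero]
    · rw [h2, ih.fy, ih.eu]
      rcases p with _ | p
      · simp [smul_eq_C_mul, C_two]; ring
      · simp [smul_eq_C_mul, C_two]; ring
    · rw [h3, ih.fyb]; simp [smul_eq_C_mul, C_two]; ring
    · rw [h4, ih.eu]; simp [smul_eq_C_mul, C_two]; ring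
    · rw [h5, ih.eub]; simp [smul_eq_C_mul, C_two]; ring
    · rw [h6, ih.hh]; simp [smul_eq_C_mul, C_two]; ring

/-- The recursion satisfied by the coefficients. -/
lemma Gam_rec (n m r l p q : ℕ) :
    Gam n m r l (p + 1) q * (((p + 1) * (n + r + (p + 1) + 1) : ℕ) : ℂ) +
      Gam n m r l p (q + 1) * (((q + 1) * (m + r + (q + 1) + 1) : ℕ) : ℂ) = 0 := by
  have e1 : (n + r + (p + 1) + 1).factorial = (n + r + p + 2) * (n + r + p + 1).factorial :=
    Nat.factorial_succ _
  have e2 : (m + r + (q + 1) + 1).factorial = (m + r + q + 2) * (m + r + q + 1).factorial :=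
    Nat.factorial_succ _
  have a1 : ((n : ℂ) + r + p + 2) ≠ 0 := by exact_mod_cast Nat.succ_ne_zero (n + r + p + 1)
  have a2 : ((m : ℂ) + r + q + 2) ≠ 0 := by exact_mod_cast Nat.succ_ne_zero (m + r + q + 1)
  have a3 : ((p : ℂ) + 1) ≠ 0 := by exact_mod_cast Nat.succ_ne_zero p
  have a4 : ((q : ℂ) + 1) ≠ 0 := by exact_mod_cast Nat.succ_ne_zero q
  have b (k : ℕ) : (k.factorial : ℂ) ≠ 0 := by exact_mod_cast k.factorial_ne_zero
  have b1 := b p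
  have b2 := b q
  have b3 := b (n + r + p + 1)
  have b4 := b (m + r + q + 1)
  unfold Gam
  rw [e1, e2, Nat.factorial_succ p, Nat.factorial_succ q, pow_succ]
  push_cast
  have e3 : (n : ℂ) + r + (p + 1) + 1 = n + r + p + 2 := by ring
  have e4 : (m : ℂ) + r + (q + 1) + 1 = m + r + q + 2 := by ring
  rw [e3, e4]
  field_simp
  ring

theorem stmt9 (n m r l : ℕ) (P : R12) (hP : BihomW (n + r) (m + r) P) :
    Psi9 n m r l P ∈ MvPolynomial.supported ℂ (Set.range Sum.inl) ∧
    Eh (Psi9 n m r l P) = 0 ∧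
    Fv (Psi9 n m r l P) = 0 ∧
    Hh (Psi9 n m r l P) = ((n + m : ℕ) : ℂ) • Psi9 n m r l P ∧
    Hv (Psi9 n m r l P) = ((n + m + 2 * r + 2 * l + 4 : ℕ) : ℂ) • Psi9 n m r l P := by
  have hG := good_all hP.1 n m r
  have hS : (DX ^ r) ((D1 ^ n) ((Db1 ^ m) P)) ∈
      MvPolynomial.supported ℂ (Set.range Sum.inl : Set Idx12) := by
    apply BH.supp
    apply BH.DX_pow
    apply BH.D1_pow
    apply BH.Db1_pow
    refine ⟨?_, ?_⟩
    · rw [show 0 + r + n = n + r by ring]; exact hP.2.1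
    · rw [show 0 + r + m = m + r by ring]; exact hP.2.2
  unfold Psi9
  set Q := (DX ^ r) ((D1 ^ n) ((Db1 ^ m) P)) with hQ
  have h2 := fun p q => hG.two p q
  refine ⟨?_, ?_, ?_, ?_, ?_⟩
  · refine sum_mem fun p _ => Subalgebra.smul_mem _ ?_ _
    exact mul_mem (mul_mem (pow_mem zeta_supp _) (pow_mem zetab_supp _)) hS
  · rw [map_sum]
    refine Finset.sum_eq_zero fun p _ => ?_
    rw [map_smul, (h2 _ _).eh, smul_zero]
  · simp only [Fv_ap, map_sum, map_smul, (h2 _ _).fy, (h2 _ _).fyb]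
    simp only [smul_add, Finset.sum_add_distrib]
    rw [Finset.sum_range_succ', Finset.sum_range_succ (n := l)]
    simp only [zero_mul, Nat.cast_zero, neg_zero, zero_smul, smul_zero, add_zero, Nat.sub_self]
    rw [← Finset.sum_add_distrib]
    refine Finset.sum_eq_zero fun p hp => ?_
    obtain ⟨q, rfl⟩ := Nat.exists_eq_add_of_lt (Finset.mem_range.mp hp)
    have e1 : p + q + 1 - (p + 1) = q := by omega
    have e2 : p + q + 1 - p = q + 1 := by omega
    rw [e1, e2, Nat.add_sub_cancel, Nat.add_sub_cancel, smul_smul, smul_smul, ← add_smul,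
      mul_neg, mul_neg, ← neg_add, Gam_rec, neg_zero, zero_smul]
  · rw [map_sum, Finset.smul_sum]
    refine Finset.sum_congr rfl fun p _ => ?_
    rw [map_smul, (h2 _ _).hh, smul_comm]
  · rw [map_sum, Finset.smul_sum]
    refine Finset.sum_congr rfl fun p hp => ?_
    obtain ⟨q, rfl⟩ := Nat.exists_eq_add_of_le (Nat.lt_succ_iff.mp (Finset.mem_range.mp hp))
    rw [map_smul, Nat.add_sub_cancel_left, smul_comm, Hv_ap, (h2 _ _).eu, (h2 _ _).eub,
      ← add_smul, ← add_smul]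
    congr 2
    push_cast
    ring

end
end

section
/- Let a, b, ā, b̄ ≥ 0 be integers and let P ∈ W be bihomogeneous of bidegree (a+b, ā+b̄). Set c_{k,l} = b!·b̄!·(a+b+1)·(ā+b̄+1) / (i^{k+l} · k! · l! · (b−k)! · (b̄−l)! · (a+b+l+1)! · (ā+b̄+k+1)!) and define Ψ = Σ_{k=0}^{b} Σ_{l=0}^{b̄} c_{k,l} · ζ^l ζ̄^k · D₁^{a+k} D̄₁^{ā+l} D₂^{b−k} D̄₂^{b̄−l} P. Then Ψ lies in R (it contains no u, ū variables), and F₁ Ψ = 0, F₂ Ψ = 0, H₁ Ψ = (ā − a + b + b̄ + 2)·Ψ, H₂ Ψ = (a − ā + b + b̄ + 2)·Ψ. -/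
/-!
Context: the polynomial ring in the eight variables `y_i^α, ȳ_i^{α̇}` (indexed by
`Sum.inl`) together with the four auxiliary variables `u^α, ū^{α̇}` (indexed by
`Sum.inr`); R = ℂ[y,ȳ] sits inside it as the polynomials supported on `Sum.inl`,
and W = ℂ[u,ū] as those supported on `Sum.inr`.
-/

noncomputable section

open MvPolynomial

/-- `F₁ = Σ_α y₁^α ∂_{2α} − i·(∂̄_{11}∂̄_{22} − ∂̄_{12}∂̄_{21})`. -/
def F1 : Module.End ℂ R12 :=
  (∑ a, mulOp (yv 0 a) * dy 1 a) - Complex.I • (dyb 0 0 * dyb 1 1 - dyb 0 1 * dyb 1 0)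

/-- `F₂ = Σ_{α̇} ȳ₁^{α̇} ∂̄_{2α̇} − i·(∂_{11}∂_{22} − ∂_{12}∂_{21})`. -/
def F2 : Module.End ℂ R12 :=
  (∑ a, mulOp (ybv 0 a) * dyb 1 a) - Complex.I • (dy 0 0 * dy 1 1 - dy 0 1 * dy 1 0)

/-- `H₁ = Σ_{α̇} ȳ₁^{α̇}∂̄_{1α̇} − Σ_α y₁^α∂_{1α} + Σ_α y₂^α∂_{2α} + Σ_{α̇} ȳ₂^{α̇}∂̄_{2α̇} + 2·id`. -/
def H1 : Module.End ℂ R12 :=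
  (∑ a, mulOp (ybv 0 a) * dyb 0 a) - (∑ a, mulOp (yv 0 a) * dy 0 a) +
    (∑ a, mulOp (yv 1 a) * dy 1 a) + (∑ a, mulOp (ybv 1 a) * dyb 1 a) +
    (2 : ℂ) • (1 : Module.End ℂ R12)

/-- `H₂ = Σ_α y₁^α∂_{1α} − Σ_{α̇} ȳ₁^{α̇}∂̄_{1α̇} + Σ_α y₂^α∂_{2α} + Σ_{α̇} ȳ₂^{α̇}∂̄_{2α̇} + 2·id`. -/
def H2 : Module.End ℂ R12 :=
  (∑ a, mulOp (yv 0 a) * dy 0 a) - (∑ a, mulOp (ybv 0 a) * dyb 0 a) +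
    (∑ a, mulOp (yv 1 a) * dy 1 a) + (∑ a, mulOp (ybv 1 a) * dyb 1 a) +
    (2 : ℂ) • (1 : Module.End ℂ R12)

/-- The coefficient
`c_{k,l} = b!·b̄!·(a+b+1)·(ā+b̄+1) / (i^{k+l} k! l! (b−k)! (b̄−l)! (a+b+l+1)! (ā+b̄+k+1)!)`. -/
def cMom (a b abar bbar k l : ℕ) : ℂ :=
  ((Nat.factorial b : ℂ) * (Nat.factorial bbar : ℂ) * ((a + b + 1 : ℕ) : ℂ) *
      ((abar + bbar + 1 : ℕ) : ℂ)) /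
    (Complex.I ^ (k + l) * (Nat.factorial k : ℂ) * (Nat.factorial l : ℂ) *
      (Nat.factorial (b - k) : ℂ) * (Nat.factorial (bbar - l) : ℂ) *
      (Nat.factorial (a + b + l + 1) : ℂ) * (Nat.factorial (abar + bbar + k + 1) : ℂ))

/-- `Ψ = Σ_{k=0}^{b} Σ_{l=0}^{b̄} c_{k,l} ζ^l ζ̄^k · D₁^{a+k} D̄₁^{ā+l} D₂^{b−k} D̄₂^{b̄−l} P`. -/
def Psi12 (a b abar bbar : ℕ) (P : R12) : R12 :=
  ∑ k ∈ Finset.range (b + 1), ∑ l ∈ Finset.range (bbar + 1),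
    cMom a b abar bbar k l •
      (zeta ^ l * zetab ^ k *
        ((D1 ^ (a + k)) ((Db1 ^ (abar + l)) ((D2 ^ (b - k)) ((Db2 ^ (bbar - l)) P)))))

set_option linter.all false

/-! ### Auxiliary derivations and commutators -/

def vD (i : Fin 2) : Derivation ℂ R12 R12 := ∑ a, yv i a • pderiv (Sum.inr (Sum.inl a))
def vDb (i : Fin 2) : Derivation ℂ R12 R12 := ∑ a, ybv i a • pderiv (Sum.inr (Sum.inr a))
def vE (i j : Fin 2) : Derivation ℂ R12 R12 := ∑ a, yv i a • pderiv (Sum.inl (Sum.inl (j, a)))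
def vEb (i j : Fin 2) : Derivation ℂ R12 R12 := ∑ a, ybv i a • pderiv (Sum.inl (Sum.inr (j, a)))

lemma D1_eq : D1 = (vD 0).toLinearMap := by
  refine LinearMap.ext fun x => ?_; simp [D1, vD, mulOp, du]
lemma D2_eq : D2 = (vD 1).toLinearMap := by
  refine LinearMap.ext fun x => ?_; simp [D2, vD, mulOp, du]
lemma Db1_eq : Db1 = (vDb 0).toLinearMap := by
  refine LinearMap.ext fun x => ?_; simp [Db1, vDb, mulOp, dub]
lemma Db2_eq : Db2 = (vDb 1).toLinearMap := by
  refine LinearMap.ext fun x => ?_; simp [Db2, vDb, mulOp, dub]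
lemma sum_dy_eq (i j : Fin 2) :
    (∑ a, mulOp (yv i a) * dy j a) = (vE i j).toLinearMap := by
  refine LinearMap.ext fun x => ?_; simp [vE, mulOp, dy]
lemma sum_dyb_eq (i j : Fin 2) :
    (∑ a, mulOp (ybv i a) * dyb j a) = (vEb i j).toLinearMap := by
  refine LinearMap.ext fun x => ?_; simp [vEb, mulOp, dyb]

lemma comm_aux (A B C : Derivation ℂ R12 R12)
    (h : ∀ i, A (B (X i)) = B (A (X i)) + C (X i)) (x : R12) :
    A (B x) = B (A x) + C x := by
  have : ⁅A, B⁆ = C := by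
    apply MvPolynomial.derivation_ext
    intro i
    rw [Derivation.commutator_apply, h]; ring
  rw [← this, Derivation.commutator_apply]; ring

lemma comm_aux0 (A B : Derivation ℂ R12 R12)
    (h : ∀ i, A (B (X i)) = B (A (X i))) (x : R12) :
    A (B x) = B (A x) := by
  have := comm_aux A B 0 (by simpa using h) x
  simpa using this

abbrev py (i a : Fin 2) : Derivation ℂ R12 R12 := pderiv (Sum.inl (Sum.inl (i, a)))
abbrev pyb (i a : Fin 2) : Derivation ℂ R12 R12 := pderiv (Sum.inl (Sum.inr (i, a)))
abbrev pu (a : Fin 2) : Derivation ℂ R12 R12 := pderiv (Sum.inr (Sum.inl a))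
abbrev pub (a : Fin 2) : Derivation ℂ R12 R12 := pderiv (Sum.inr (Sum.inr a))

lemma pd_ite (s t : Idx12) : (pderiv s (X t : R12)) = if t = s then 1 else 0 := by
  rw [pderiv_X, Pi.single_apply]

lemma vD_Xy (i p q : Fin 2) : vD i (X (Sum.inl (Sum.inl (p, q)))) = 0 := by
  simp [vD, pd_ite]
lemma vD_Xyb (i p q : Fin 2) : vD i (X (Sum.inl (Sum.inr (p, q)))) = 0 := by
  simp [vD, pd_ite]
lemma vD_Xu (i p : Fin 2) : vD i (X (Sum.inr (Sum.inl p))) = yv i p := by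
  fin_cases p <;> simp [vD, pd_ite]
lemma vD_Xub (i p : Fin 2) : vD i (X (Sum.inr (Sum.inr p))) = 0 := by
  simp [vD, pd_ite]
lemma vDb_Xy (i p q : Fin 2) : vDb i (X (Sum.inl (Sum.inl (p, q)))) = 0 := by
  simp [vDb, pd_ite]
lemma vDb_Xyb (i p q : Fin 2) : vDb i (X (Sum.inl (Sum.inr (p, q)))) = 0 := by
  simp [vDb, pd_ite]
lemma vDb_Xu (i p : Fin 2) : vDb i (X (Sum.inr (Sum.inl p))) = 0 := by
  simp [vDb, pd_ite]
lemma vDb_Xub (i p : Fin 2) : vDb i (X (Sum.inr (Sum.inr p))) = ybv i p := by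
  fin_cases p <;> simp [vDb, pd_ite]
lemma vE_Xy (i j p q : Fin 2) : vE i j (X (Sum.inl (Sum.inl (p, q)))) = if p = j then yv i q else 0 := by
  by_cases h : p = j <;> fin_cases q <;> simp [vE, pd_ite, h]
lemma vE_Xyb (i j p q : Fin 2) : vE i j (X (Sum.inl (Sum.inr (p, q)))) = 0 := by
  simp [vE, pd_ite]
lemma vE_Xu (i j p : Fin 2) : vE i j (X (Sum.inr (Sum.inl p))) = 0 := by
  simp [vE, pd_ite]
lemma vE_Xub (i j p : Fin 2) : vE i j (X (Sum.inr (Sum.inr p))) = 0 := by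
  simp [vE, pd_ite]
lemma vEb_Xy (i j p q : Fin 2) : vEb i j (X (Sum.inl (Sum.inl (p, q)))) = 0 := by
  simp [vEb, pd_ite]
lemma vEb_Xyb (i j p q : Fin 2) : vEb i j (X (Sum.inl (Sum.inr (p, q)))) = if p = j then ybv i q else 0 := by
  by_cases h : p = j <;> fin_cases q <;> simp [vEb, pd_ite, h]
lemma vEb_Xu (i j p : Fin 2) : vEb i j (X (Sum.inr (Sum.inl p))) = 0 := by
  simp [vEb, pd_ite]
lemma vEb_Xub (i j p : Fin 2) : vEb i j (X (Sum.inr (Sum.inr p))) = 0 := by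
  simp [vEb, pd_ite]

lemma vE_vD (i j : Fin 2) (x : R12) :
    vE i j (vD j x) = vD j (vE i j x) + vD i x := by
  apply comm_aux
  rintro ((⟨p, q⟩ | ⟨p, q⟩) | (p | p)) <;>
    simp only [vE_Xy, vE_Xyb, vE_Xu, vE_Xub, vD_Xy, vD_Xyb, vD_Xu, vD_Xub, yv, ybv, map_zero] <;> (repeat' split_ifs) <;>
    simp_all [vE_Xy, vE_Xyb, vE_Xu, vE_Xub, vD_Xy, vD_Xyb, vD_Xu, vD_Xub, yv, ybv, map_zero]

lemma vE_vD_ne (i j k : Fin 2) (h : j ≠ k) (x : R12) :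
    vE i j (vD k x) = vD k (vE i j x) := by
  apply comm_aux0
  rintro ((⟨p, q⟩ | ⟨p, q⟩) | (p | p)) <;>
    simp only [vE_Xy, vE_Xyb, vE_Xu, vE_Xub, vD_Xy, vD_Xyb, vD_Xu, vD_Xub, yv, ybv, map_zero] <;> (repeat' split_ifs) <;>
    simp_all [vE_Xy, vE_Xyb, vE_Xu, vE_Xub, vD_Xy, vD_Xyb, vD_Xu, vD_Xub, yv, ybv, map_zero]

lemma vE_vDb (i j k : Fin 2) (x : R12) :
    vE i j (vDb k x) = vDb k (vE i j x) := by
  apply comm_aux0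
  rintro ((⟨p, q⟩ | ⟨p, q⟩) | (p | p)) <;>
    simp only [vE_Xy, vE_Xyb, vE_Xu, vE_Xub, vDb_Xy, vDb_Xyb, vDb_Xu, vDb_Xub, yv, ybv, map_zero] <;> (repeat' split_ifs) <;>
    simp_all [vE_Xy, vE_Xyb, vE_Xu, vE_Xub, vDb_Xy, vDb_Xyb, vDb_Xu, vDb_Xub, yv, ybv, map_zero]

lemma vD_vD (i j : Fin 2) (x : R12) :
    vD i (vD j x) = vD j (vD i x) := by
  apply comm_aux0
  rintro ((⟨p, q⟩ | ⟨p, q⟩) | (p | p)) <;>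
    simp only [vD_Xy, vD_Xyb, vD_Xu, vD_Xub, yv, ybv, map_zero] <;> (repeat' split_ifs) <;>
    simp_all [vD_Xy, vD_Xyb, vD_Xu, vD_Xub, yv, ybv, map_zero]

lemma py_vD (i a : Fin 2) (x : R12) :
    py i a (vD i x) = vD i (py i a x) + pu a x := by
  apply comm_aux
  rintro ((⟨p, q⟩ | ⟨p, q⟩) | (p | p)) <;>
    simp only [vD_Xy, vD_Xyb, vD_Xu, vD_Xub, yv, ybv, pd_ite, map_zero] <;> (repeat' split_ifs) <;>
    simp_all [vD_Xy, vD_Xyb, vD_Xu, vD_Xub, yv, ybv, pd_ite, map_zero]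

lemma py_vD_ne (i k a : Fin 2) (h : i ≠ k) (x : R12) :
    py i a (vD k x) = vD k (py i a x) := by
  apply comm_aux0
  rintro ((⟨p, q⟩ | ⟨p, q⟩) | (p | p)) <;>
    simp only [vD_Xy, vD_Xyb, vD_Xu, vD_Xub, yv, ybv, pd_ite, map_zero] <;> (repeat' split_ifs) <;>
    simp_all [vD_Xy, vD_Xyb, vD_Xu, vD_Xub, yv, ybv, pd_ite, map_zero]

lemma py_vDb (i k a : Fin 2) (x : R12) :
    py i a (vDb k x) = vDb k (py i a x) := by
  apply comm_aux0
  rintro ((⟨p, q⟩ | ⟨p, q⟩) | (p | p)) <;>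
    simp only [vDb_Xy, vDb_Xyb, vDb_Xu, vDb_Xub, yv, ybv, pd_ite, map_zero] <;> (repeat' split_ifs) <;>
    simp_all [vDb_Xy, vDb_Xyb, vDb_Xu, vDb_Xub, yv, ybv, pd_ite, map_zero]

lemma pu_vD (k a : Fin 2) (x : R12) :
    pu a (vD k x) = vD k (pu a x) := by
  apply comm_aux0
  rintro ((⟨p, q⟩ | ⟨p, q⟩) | (p | p)) <;>
    simp only [vD_Xy, vD_Xyb, vD_Xu, vD_Xub, yv, ybv, pd_ite, map_zero] <;> (repeat' split_ifs) <;>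
    simp_all [vD_Xy, vD_Xyb, vD_Xu, vD_Xub, yv, ybv, pd_ite, map_zero]

lemma pu_vDb (k a : Fin 2) (x : R12) :
    pu a (vDb k x) = vDb k (pu a x) := by
  apply comm_aux0
  rintro ((⟨p, q⟩ | ⟨p, q⟩) | (p | p)) <;>
    simp only [vDb_Xy, vDb_Xyb, vDb_Xu, vDb_Xub, yv, ybv, pd_ite, map_zero] <;> (repeat' split_ifs) <;>
    simp_all [vDb_Xy, vDb_Xyb, vDb_Xu, vDb_Xub, yv, ybv, pd_ite, map_zero]

lemma vEb_vDb (i j : Fin 2) (x : R12) :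
    vEb i j (vDb j x) = vDb j (vEb i j x) + vDb i x := by
  apply comm_aux
  rintro ((⟨p, q⟩ | ⟨p, q⟩) | (p | p)) <;>
    simp only [vEb_Xy, vEb_Xyb, vEb_Xu, vEb_Xub, vDb_Xy, vDb_Xyb, vDb_Xu, vDb_Xub, yv, ybv, map_zero] <;> (repeat' split_ifs) <;>
    simp_all [vEb_Xy, vEb_Xyb, vEb_Xu, vEb_Xub, vDb_Xy, vDb_Xyb, vDb_Xu, vDb_Xub, yv, ybv, map_zero]

lemma vEb_vDb_ne (i j k : Fin 2) (h : j ≠ k) (x : R12) :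
    vEb i j (vDb k x) = vDb k (vEb i j x) := by
  apply comm_aux0
  rintro ((⟨p, q⟩ | ⟨p, q⟩) | (p | p)) <;>
    simp only [vEb_Xy, vEb_Xyb, vEb_Xu, vEb_Xub, vDb_Xy, vDb_Xyb, vDb_Xu, vDb_Xub, yv, ybv, map_zero] <;> (repeat' split_ifs) <;>
    simp_all [vEb_Xy, vEb_Xyb, vEb_Xu, vEb_Xub, vDb_Xy, vDb_Xyb, vDb_Xu, vDb_Xub, yv, ybv, map_zero]

lemma vEb_vD (i j k : Fin 2) (x : R12) :
    vEb i j (vD k x) = vD k (vEb i j x) := by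
  apply comm_aux0
  rintro ((⟨p, q⟩ | ⟨p, q⟩) | (p | p)) <;>
    simp only [vEb_Xy, vEb_Xyb, vEb_Xu, vEb_Xub, vD_Xy, vD_Xyb, vD_Xu, vD_Xub, yv, ybv, map_zero] <;> (repeat' split_ifs) <;>
    simp_all [vEb_Xy, vEb_Xyb, vEb_Xu, vEb_Xub, vD_Xy, vD_Xyb, vD_Xu, vD_Xub, yv, ybv, map_zero]

lemma vDb_vDb (i j : Fin 2) (x : R12) :
    vDb i (vDb j x) = vDb j (vDb i x) := by
  apply comm_aux0
  rintro ((⟨p, q⟩ | ⟨p, q⟩) | (p | p)) <;>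
    simp only [vDb_Xy, vDb_Xyb, vDb_Xu, vDb_Xub, yv, ybv, map_zero] <;> (repeat' split_ifs) <;>
    simp_all [vDb_Xy, vDb_Xyb, vDb_Xu, vDb_Xub, yv, ybv, map_zero]

lemma pyb_vDb (i a : Fin 2) (x : R12) :
    pyb i a (vDb i x) = vDb i (pyb i a x) + pub a x := by
  apply comm_aux
  rintro ((⟨p, q⟩ | ⟨p, q⟩) | (p | p)) <;>
    simp only [vDb_Xy, vDb_Xyb, vDb_Xu, vDb_Xub, yv, ybv, pd_ite, map_zero] <;> (repeat' split_ifs) <;>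
    simp_all [vDb_Xy, vDb_Xyb, vDb_Xu, vDb_Xub, yv, ybv, pd_ite, map_zero]

lemma pyb_vDb_ne (i k a : Fin 2) (h : i ≠ k) (x : R12) :
    pyb i a (vDb k x) = vDb k (pyb i a x) := by
  apply comm_aux0
  rintro ((⟨p, q⟩ | ⟨p, q⟩) | (p | p)) <;>
    simp only [vDb_Xy, vDb_Xyb, vDb_Xu, vDb_Xub, yv, ybv, pd_ite, map_zero] <;> (repeat' split_ifs) <;>
    simp_all [vDb_Xy, vDb_Xyb, vDb_Xu, vDb_Xub, yv, ybv, pd_ite, map_zero]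

lemma pyb_vD (i k a : Fin 2) (x : R12) :
    pyb i a (vD k x) = vD k (pyb i a x) := by
  apply comm_aux0
  rintro ((⟨p, q⟩ | ⟨p, q⟩) | (p | p)) <;>
    simp only [vD_Xy, vD_Xyb, vD_Xu, vD_Xub, yv, ybv, pd_ite, map_zero] <;> (repeat' split_ifs) <;>
    simp_all [vD_Xy, vD_Xyb, vD_Xu, vD_Xub, yv, ybv, pd_ite, map_zero]

lemma pub_vDb (k a : Fin 2) (x : R12) :
    pub a (vDb k x) = vDb k (pub a x) := by
  apply comm_aux0
  rintro ((⟨p, q⟩ | ⟨p, q⟩) | (p | p)) <;>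
    simp only [vDb_Xy, vDb_Xyb, vDb_Xu, vDb_Xub, yv, ybv, pd_ite, map_zero] <;> (repeat' split_ifs) <;>
    simp_all [vDb_Xy, vDb_Xyb, vDb_Xu, vDb_Xub, yv, ybv, pd_ite, map_zero]

lemma pub_vD (k a : Fin 2) (x : R12) :
    pub a (vD k x) = vD k (pub a x) := by
  apply comm_aux0
  rintro ((⟨p, q⟩ | ⟨p, q⟩) | (p | p)) <;>
    simp only [vD_Xy, vD_Xyb, vD_Xu, vD_Xub, yv, ybv, pd_ite, map_zero] <;> (repeat' split_ifs) <;>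
    simp_all [vD_Xy, vD_Xyb, vD_Xu, vD_Xub, yv, ybv, pd_ite, map_zero]

lemma vD_vDb (i j : Fin 2) (x : R12) :
    vD i (vDb j x) = vDb j (vD i x) := by
  apply comm_aux0
  rintro ((⟨p, q⟩ | ⟨p, q⟩) | (p | p)) <;>
    simp only [vD_Xy, vD_Xyb, vD_Xu, vD_Xub, vDb_Xy, vDb_Xyb, vDb_Xu, vDb_Xub, yv, ybv, map_zero] <;> (repeat' split_ifs) <;>
    simp_all [vD_Xy, vD_Xyb, vD_Xu, vD_Xub, vDb_Xy, vDb_Xyb, vDb_Xu, vDb_Xub, yv, ybv, map_zero]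

lemma pd_comm (s t : Idx12) (x : R12) :
    pderiv s (pderiv t x) = pderiv t (pderiv s x) := by
  apply comm_aux0
  intro i
  simp only [pderiv_X, Pi.single_apply]
  split_ifs <;> simp

/-! ### Powers -/

lemma pow_comm0 (A : Derivation ℂ R12 R12) (B : Module.End ℂ R12)
    (h : ∀ x, A (B x) = B (A x)) (n : ℕ) (x : R12) :
    A ((B ^ n) x) = (B ^ n) (A x) := by
  induction n generalizing x with
  | zero => simp
  | succ n ih => rw [pow_succ, Module.End.mul_apply, ih, h, Module.End.mul_apply]

lemma pow_comm1 (A C : Derivation ℂ R12 R12) (B : Module.End ℂ R12)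
    (h : ∀ x, A (B x) = B (A x) + C x) (hC : ∀ x, C (B x) = B (C x)) (n : ℕ) (x : R12) :
    A ((B ^ n) x) = (B ^ n) (A x) + (n : ℂ) • (B ^ (n - 1)) (C x) := by
  induction n generalizing x with
  | zero => simp
  | succ n ih =>
    rw [pow_succ, Module.End.mul_apply, ih, h, Module.End.mul_apply, map_add, hC]
    rcases n with _ | n
    · simp
    · rw [Nat.add_sub_cancel, Nat.add_sub_cancel, pow_succ B n, Module.End.mul_apply,
        Module.End.mul_apply, add_assoc]
      push_cast
      module

/-! ### The building blocks `Q` -/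

lemma D1_ap_s12 (x : R12) : D1 x = vD 0 x := by rw [D1_eq]; rfl
lemma D2_ap_s12 (x : R12) : D2 x = vD 1 x := by rw [D2_eq]; rfl
lemma Db1_ap_s12 (x : R12) : Db1 x = vDb 0 x := by rw [Db1_eq]; rfl
lemma Db2_ap_s12 (x : R12) : Db2 x = vDb 1 x := by rw [Db2_eq]; rfl

lemma pow_eig (A : Derivation ℂ R12 R12) (B : Module.End ℂ R12)
    (h : ∀ x, A (B x) = B (A x) + B x) (n : ℕ) (x : R12) :
    A ((B ^ n) x) = (B ^ n) (A x) + (n : ℂ) • (B ^ n) x := by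
  induction n generalizing x with
  | zero => simp
  | succ n ih =>
    rw [pow_succ, Module.End.mul_apply, ih, h, Module.End.mul_apply, map_add]
    push_cast
    module

def Q (m mb n nb : ℕ) (P : R12) : R12 := (D1 ^ m) ((Db1 ^ mb) ((D2 ^ n) ((Db2 ^ nb) P)))

/-- Moving a derivation commuting with everything through `Q`. -/
lemma Q_comm (A : Derivation ℂ R12 R12) (h1 : ∀ x, A (D1 x) = D1 (A x))
    (h2 : ∀ x, A (Db1 x) = Db1 (A x)) (h3 : ∀ x, A (D2 x) = D2 (A x))
    (h4 : ∀ x, A (Db2 x) = Db2 (A x)) (m mb n nb : ℕ) (P : R12) :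
    A (Q m mb n nb P) = Q m mb n nb (A P) := by
  rw [Q, pow_comm0 A D1 h1, pow_comm0 A Db1 h2, pow_comm0 A D2 h3, pow_comm0 A Db2 h4, Q]

lemma vE01_Q (m mb n nb : ℕ) (P : R12) (hP : vE 0 1 P = 0) :
    vE 0 1 (Q m mb n nb P) = (n : ℂ) • Q (m + 1) mb (n - 1) nb P := by
  rw [Q, pow_comm0 _ D1 (fun x => by simp only [D1_ap_s12]; exact vE_vD_ne _ _ _ (by decide) x),
    pow_comm0 _ Db1 (fun x => by simp only [Db1_ap_s12]; exact vE_vDb _ _ _ x),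
    pow_comm1 _ (vD 0) D2 (fun x => by simp only [D2_ap_s12]; exact vE_vD _ _ x)
      (fun x => by simp only [D2_ap_s12]; exact vD_vD _ _ x),
    pow_comm0 _ Db2 (fun x => by simp only [Db2_ap_s12]; exact vE_vDb _ _ _ x), hP,
    ← pow_comm0 (vD 0) D2 (fun x => by simp only [D2_ap_s12]; exact vD_vD _ _ x)]
  simp only [map_zero, zero_add, map_smul]
  rw [← pow_comm0 (vD 0) Db1 (fun x => by simp only [Db1_ap_s12]; exact vD_vDb _ _ x), ← D1_ap_s12,
    ← Module.End.mul_apply, ← pow_succ, Q]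

lemma vEb01_Q (m mb n nb : ℕ) (P : R12) (hP : vEb 0 1 P = 0) :
    vEb 0 1 (Q m mb n nb P) = (nb : ℂ) • Q m (mb + 1) n (nb - 1) P := by
  rw [Q, pow_comm0 _ D1 (fun x => by simp only [D1_ap_s12]; exact vEb_vD _ _ _ x),
    pow_comm0 _ Db1 (fun x => by simp only [Db1_ap_s12]; exact vEb_vDb_ne _ _ _ (by decide) x),
    pow_comm0 _ D2 (fun x => by simp only [D2_ap_s12]; exact vEb_vD _ _ _ x),
    pow_comm1 _ (vDb 0) Db2 (fun x => by simp only [Db2_ap_s12]; exact vEb_vDb _ _ x)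
      (fun x => by simp only [Db2_ap_s12]; exact vDb_vDb _ _ x), hP,
    ← pow_comm0 (vDb 0) Db2 (fun x => by simp only [Db2_ap_s12]; exact vDb_vDb _ _ x)]
  simp only [map_zero, zero_add, map_smul]
  rw [← pow_comm0 (vDb 0) D2 (fun x => by simp only [D2_ap_s12]; exact (vD_vDb _ _ x).symm), ← Db1_ap_s12, Q,
    pow_succ Db1, Module.End.mul_apply]

lemma vE00_Q (m mb n nb : ℕ) (P : R12) (hP : vE 0 0 P = 0) :
    vE 0 0 (Q m mb n nb P) = (m : ℂ) • Q m mb n nb P := by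
  rw [Q, pow_eig _ D1 (fun x => by simp only [D1_ap_s12]; exact vE_vD _ _ x),
    pow_comm0 _ Db1 (fun x => by simp only [Db1_ap_s12]; exact vE_vDb _ _ _ x),
    pow_comm0 _ D2 (fun x => by simp only [D2_ap_s12]; exact vE_vD_ne _ _ _ (by decide) x),
    pow_comm0 _ Db2 (fun x => by simp only [Db2_ap_s12]; exact vE_vDb _ _ _ x), hP]
  simp only [map_zero, zero_add]

lemma vE11_Q (m mb n nb : ℕ) (P : R12) (hP : vE 1 1 P = 0) :
    vE 1 1 (Q m mb n nb P) = (n : ℂ) • Q m mb n nb P := by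
  rw [Q, pow_comm0 _ D1 (fun x => by simp only [D1_ap_s12]; exact vE_vD_ne _ _ _ (by decide) x),
    pow_comm0 _ Db1 (fun x => by simp only [Db1_ap_s12]; exact vE_vDb _ _ _ x),
    pow_eig _ D2 (fun x => by simp only [D2_ap_s12]; exact vE_vD _ _ x),
    pow_comm0 _ Db2 (fun x => by simp only [Db2_ap_s12]; exact vE_vDb _ _ _ x), hP]
  simp only [map_zero, zero_add, map_smul]

lemma vEb00_Q (m mb n nb : ℕ) (P : R12) (hP : vEb 0 0 P = 0) :
    vEb 0 0 (Q m mb n nb P) = (mb : ℂ) • Q m mb n nb P := by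
  rw [Q, pow_comm0 _ D1 (fun x => by simp only [D1_ap_s12]; exact vEb_vD _ _ _ x),
    pow_eig _ Db1 (fun x => by simp only [Db1_ap_s12]; exact vEb_vDb _ _ x),
    pow_comm0 _ D2 (fun x => by simp only [D2_ap_s12]; exact vEb_vD _ _ _ x),
    pow_comm0 _ Db2 (fun x => by simp only [Db2_ap_s12]; exact vEb_vDb_ne _ _ _ (by decide) x), hP]
  simp only [map_zero, zero_add, map_smul]

lemma vEb11_Q (m mb n nb : ℕ) (P : R12) (hP : vEb 1 1 P = 0) :
    vEb 1 1 (Q m mb n nb P) = (nb : ℂ) • Q m mb n nb P := by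
  rw [Q, pow_comm0 _ D1 (fun x => by simp only [D1_ap_s12]; exact vEb_vD _ _ _ x),
    pow_comm0 _ Db1 (fun x => by simp only [Db1_ap_s12]; exact vEb_vDb_ne _ _ _ (by decide) x),
    pow_comm0 _ D2 (fun x => by simp only [D2_ap_s12]; exact vEb_vD _ _ _ x),
    pow_eig _ Db2 (fun x => by simp only [Db2_ap_s12]; exact vEb_vDb _ _ x), hP]
  simp only [map_zero, zero_add, map_smul]

lemma py0_Q (a : Fin 2) (m mb n nb : ℕ) (P : R12) (hP : py 0 a P = 0) :
    py 0 a (Q m mb n nb P) = (m : ℂ) • Q (m - 1) mb n nb (pu a P) := by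
  rw [Q, pow_comm1 _ (pu a) D1 (fun x => by simp only [D1_ap_s12]; exact py_vD _ _ x)
      (fun x => by simp only [D1_ap_s12]; exact pu_vD _ _ x),
    pow_comm0 (py 0 a) Db1 (fun x => by simp only [Db1_ap_s12]; exact py_vDb _ _ _ x),
    pow_comm0 (py 0 a) D2 (fun x => by simp only [D2_ap_s12]; exact py_vD_ne _ _ _ (by decide) x),
    pow_comm0 (py 0 a) Db2 (fun x => by simp only [Db2_ap_s12]; exact py_vDb _ _ _ x), hP,
    pow_comm0 (pu a) Db1 (fun x => by simp only [Db1_ap_s12]; exact pu_vDb _ _ x),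
    pow_comm0 (pu a) D2 (fun x => by simp only [D2_ap_s12]; exact pu_vD _ _ x),
    pow_comm0 (pu a) Db2 (fun x => by simp only [Db2_ap_s12]; exact pu_vDb _ _ x), Q]
  simp only [map_zero, zero_add]

lemma py1_Q (a : Fin 2) (m mb n nb : ℕ) (P : R12) (hP : py 1 a P = 0) :
    py 1 a (Q m mb n nb P) = (n : ℂ) • Q m mb (n - 1) nb (pu a P) := by
  rw [Q, pow_comm0 (py 1 a) D1 (fun x => by simp only [D1_ap_s12]; exact py_vD_ne _ _ _ (by decide) x),
    pow_comm0 (py 1 a) Db1 (fun x => by simp only [Db1_ap_s12]; exact py_vDb _ _ _ x),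
    pow_comm1 _ (pu a) D2 (fun x => by simp only [D2_ap_s12]; exact py_vD _ _ x)
      (fun x => by simp only [D2_ap_s12]; exact pu_vD _ _ x),
    pow_comm0 (py 1 a) Db2 (fun x => by simp only [Db2_ap_s12]; exact py_vDb _ _ _ x), hP,
    pow_comm0 (pu a) Db2 (fun x => by simp only [Db2_ap_s12]; exact pu_vDb _ _ x), Q]
  simp only [map_zero, zero_add, map_smul]

lemma pyb0_Q (a : Fin 2) (m mb n nb : ℕ) (P : R12) (hP : pyb 0 a P = 0) :
    pyb 0 a (Q m mb n nb P) = (mb : ℂ) • Q m (mb - 1) n nb (pub a P) := by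
  rw [Q, pow_comm0 (pyb 0 a) D1 (fun x => by simp only [D1_ap_s12]; exact pyb_vD _ _ _ x),
    pow_comm1 _ (pub a) Db1 (fun x => by simp only [Db1_ap_s12]; exact pyb_vDb _ _ x)
      (fun x => by simp only [Db1_ap_s12]; exact pub_vDb _ _ x),
    pow_comm0 (pyb 0 a) D2 (fun x => by simp only [D2_ap_s12]; exact pyb_vD _ _ _ x),
    pow_comm0 (pyb 0 a) Db2 (fun x => by simp only [Db2_ap_s12]; exact pyb_vDb_ne _ _ _ (by decide) x),
    hP,
    pow_comm0 (pub a) D2 (fun x => by simp only [D2_ap_s12]; exact pub_vD _ _ x),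
    pow_comm0 (pub a) Db2 (fun x => by simp only [Db2_ap_s12]; exact pub_vDb _ _ x), Q]
  simp only [map_zero, zero_add, map_smul]

lemma pyb1_Q (a : Fin 2) (m mb n nb : ℕ) (P : R12) (hP : pyb 1 a P = 0) :
    pyb 1 a (Q m mb n nb P) = (nb : ℂ) • Q m mb n (nb - 1) (pub a P) := by
  rw [Q, pow_comm0 (pyb 1 a) D1 (fun x => by simp only [D1_ap_s12]; exact pyb_vD _ _ _ x),
    pow_comm0 (pyb 1 a) Db1 (fun x => by simp only [Db1_ap_s12]; exact pyb_vDb_ne _ _ _ (by decide) x),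
    pow_comm0 (pyb 1 a) D2 (fun x => by simp only [D2_ap_s12]; exact pyb_vD _ _ _ x),
    pow_comm1 _ (pub a) Db2 (fun x => by simp only [Db2_ap_s12]; exact pyb_vDb _ _ x)
      (fun x => by simp only [Db2_ap_s12]; exact pub_vDb _ _ x),
    hP, Q]
  simp only [map_zero, zero_add, map_smul]

/-! ### The determinant operators -/

def boxY (x : R12) : R12 := py 0 0 (py 1 1 x) - py 0 1 (py 1 0 x)
def boxYb (x : R12) : R12 := pyb 0 0 (pyb 1 1 x) - pyb 0 1 (pyb 1 0 x)

def Kill (P : R12) : Prop := ∀ j, pderiv (Sum.inl j) P = 0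

lemma Kill.pd {P : R12} (h : Kill P) (s : Idx12) : Kill (pderiv s P) := by
  intro j
  rw [pd_comm, h j, map_zero]

lemma Kill.vE {P : R12} (h : Kill P) (i j : Fin 2) : vE i j P = 0 := by
  simp [_root_.vE, h _]

lemma Kill.vEb {P : R12} (h : Kill P) (i j : Fin 2) : vEb i j P = 0 := by
  simp [_root_.vEb, h _]

lemma boxY_Q (m mb n nb : ℕ) (P : R12) (h : Kill P) : boxY (Q m mb n nb P) = 0 := by
  rw [boxY, py1_Q _ _ _ _ _ _ (h _), py1_Q _ _ _ _ _ _ (h _), Derivation.map_smul, Derivation.map_smul,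
    py0_Q _ _ _ _ _ _ (h.pd _ _), py0_Q _ _ _ _ _ _ (h.pd _ _), pd_comm, sub_self]

lemma boxYb_Q (m mb n nb : ℕ) (P : R12) (h : Kill P) : boxYb (Q m mb n nb P) = 0 := by
  rw [boxYb, pyb1_Q _ _ _ _ _ _ (h _), pyb1_Q _ _ _ _ _ _ (h _), Derivation.map_smul, Derivation.map_smul,
    pyb0_Q _ _ _ _ _ _ (h.pd _ _), pyb0_Q _ _ _ _ _ _ (h.pd _ _), pd_comm, sub_self]

lemma py_zeta (i a : Fin 2) : py i a zeta =
    if i = 0 then (if a = 0 then yv 1 1 else - yv 1 0)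
    else (if a = 0 then - yv 0 1 else yv 0 0) := by
  fin_cases i <;> fin_cases a <;> simp [py, zeta, yv]

lemma pyb_zetab (i a : Fin 2) : pyb i a zetab =
    if i = 0 then (if a = 0 then ybv 1 1 else - ybv 1 0)
    else (if a = 0 then - ybv 0 1 else ybv 0 0) := by
  fin_cases i <;> fin_cases a <;> simp [pyb, zetab, ybv]

lemma py_zetab (i a : Fin 2) : py i a zetab = 0 := by simp [py, zetab, ybv]
lemma pyb_zeta (i a : Fin 2) : pyb i a zeta = 0 := by simp [pyb, zeta, yv]
lemma vE_zetab (i j : Fin 2) : vE i j zetab = 0 := by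
  simp [zetab, ybv, vE_Xyb]
lemma vEb_zeta (i j : Fin 2) : vEb i j zeta = 0 := by
  simp [zeta, yv, vEb_Xy]
lemma vE01_zeta : vE 0 1 zeta = 0 := by
  simp [zeta, yv, vE_Xy]; ring
lemma vEb01_zetab : vEb 0 1 zetab = 0 := by
  simp [zetab, ybv, vEb_Xyb]; ring
lemma vE_zeta (i : Fin 2) : vE i i zeta = (1 : ℂ) • zeta := by
  fin_cases i <;> simp [zeta, yv, vE_Xy] <;> ring
lemma vEb_zetab (i : Fin 2) : vEb i i zetab = (1 : ℂ) • zetab := by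
  fin_cases i <;> simp [zetab, ybv, vEb_Xyb] <;> ring

lemma vE_ap (i j : Fin 2) (x : R12) :
    vE i j x = yv i 0 * py j 0 x + yv i 1 * py j 1 x := by
  simp [vE]
lemma vEb_ap (i j : Fin 2) (x : R12) :
    vEb i j x = ybv i 0 * pyb j 0 x + ybv i 1 * pyb j 1 x := by
  simp [vEb]

lemma box_abs (d00 d01 d10 d11 : Derivation ℂ R12 R12) (z y00 y01 y10 y11 g : R12)
    (h00 : d00 z = y11) (h01 : d01 z = -y10) (h10 : d10 z = -y01) (h11 : d11 z = y00)
    (e00 : d00 y00 = 1) (e01 : d01 y01 = 1) :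
    d00 (d11 (z * g)) - d01 (d10 (z * g)) = z * (d00 (d11 g) - d01 (d10 g)) +
      ((y00 * d00 g + y01 * d01 g) + (y10 * d10 g + y11 * d11 g) + (2 : ℂ) • g) := by
  have h2 : (2 : ℂ) • g = g + g := two_smul ℂ g
  simp only [Derivation.leibniz, map_add, map_neg, smul_eq_mul, h00, h01, h10, h11, e00, e01, h2]
  ring

lemma boxY_mul_zeta (g : R12) :
    boxY (zeta * g) = zeta * boxY g + ((vE 0 0 + vE 1 1) g + (2 : ℂ) • g) := by
  rw [Derivation.add_apply, vE_ap, vE_ap]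
  apply box_abs <;> first | (simp [py_zeta]; done) | simp [yv]

lemma boxYb_mul_zetab (g : R12) :
    boxYb (zetab * g) = zetab * boxYb g + ((vEb 0 0 + vEb 1 1) g + (2 : ℂ) • g) := by
  rw [Derivation.add_apply, vEb_ap, vEb_ap]
  apply box_abs <;> first | (simp [pyb_zetab]; done) | simp [ybv]

/-! ### Eigenvector bookkeeping -/

lemma eig_mul (A : Derivation ℂ R12 R12) {f g : R12} {r s : ℂ} (hf : A f = r • f)
    (hg : A g = s • g) : A (f * g) = (r + s) • (f * g) := by
  rw [Derivation.leibniz, hf, hg, smul_eq_mul, smul_eq_mul, add_smul, mul_smul_comm,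
    mul_smul_comm, mul_comm g f, add_comm]

lemma eig_pow (A : Derivation ℂ R12 R12) {f : R12} {r : ℂ} (hf : A f = r • f) (n : ℕ) :
    A (f ^ n) = (n * r) • f ^ n := by
  induction n with
  | zero => simp
  | succ n ih => rw [pow_succ, eig_mul A ih hf]; push_cast; ring_nf

lemma const_pow_mul (A : Derivation ℂ R12 R12) {f : R12} (hf : A f = 0) (n : ℕ) (x : R12) :
    A (f ^ n * x) = f ^ n * A x := by
  simp [Derivation.leibniz, Derivation.leibniz_pow, hf]

lemma box_pow_mul (box : R12 → R12) (A : Derivation ℂ R12 R12) (z : R12)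
    (hbox : ∀ g, box (z * g) = z * box g + (A g + (2 : ℂ) • g)) (hz : A z = (2 : ℂ) • z)
    (g : R12) (d : ℂ) (hg : box g = 0) (hd : A g = d • g) (k : ℕ) :
    box (z ^ k * g) = ((k : ℂ) * (k + 1 + d)) • (z ^ (k - 1) * g) := by
  induction k with
  | zero => simp [hg]
  | succ k ih =>
    rw [pow_succ', mul_assoc, hbox, ih, eig_mul A (eig_pow A hz k) hd, ← add_smul, mul_smul_comm]
    rcases k with _ | k
    · simp only [Nat.cast_zero, zero_add, Nat.cast_one]
      norm_num [add_comm]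
    · rw [Nat.add_sub_cancel, Nat.add_sub_cancel, ← mul_assoc, ← pow_succ', ← add_smul]
      congr 1
      push_cast
      ring

lemma F1_ap (x : R12) : F1 x = vE 0 1 x - Complex.I • boxYb x := by
  rw [F1, sum_dy_eq]; rfl

lemma F2_ap (x : R12) : F2 x = vEb 0 1 x - Complex.I • boxY x := by
  rw [F2, sum_dyb_eq]; rfl

lemma F1_term (k l m mb n nb : ℕ) (P : R12) (h : Kill P) :
    F1 (zeta ^ l * zetab ^ k * Q m mb n nb P) =
      (n : ℂ) • (zeta ^ l * zetab ^ k * Q (m + 1) mb (n - 1) nb P) -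
      (Complex.I * ((k : ℂ) * (k + 1 + (mb + nb)))) •
        (zeta ^ l * zetab ^ (k - 1) * Q m mb n nb P) := by
  have hb : boxYb (zeta ^ l * Q m mb n nb P) = 0 := by
    have := boxYb_Q m mb n nb P h
    rw [boxYb] at this ⊢
    simp only [const_pow_mul _ (pyb_zeta _ _)]
    rw [← mul_sub, this, mul_zero]
  have hd : (vEb 0 0 + vEb 1 1) (zeta ^ l * Q m mb n nb P) =
      ((mb : ℂ) + nb) • (zeta ^ l * Q m mb n nb P) := by
    rw [const_pow_mul _ (by simp [vEb_zeta]), Derivation.add_apply,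
      vEb00_Q _ _ _ _ _ (h.vEb _ _), vEb11_Q _ _ _ _ _ (h.vEb _ _), ← add_smul, mul_smul_comm]
  have hz : (vEb 0 0 + vEb 1 1) zetab = (2 : ℂ) • zetab := by
    rw [Derivation.add_apply, vEb_zetab, vEb_zetab, ← add_smul]; norm_num
  have key := box_pow_mul boxYb _ zetab boxYb_mul_zetab hz _ _ hb hd k
  have e : ∀ j, zeta ^ l * zetab ^ j * Q m mb n nb P =
      zetab ^ j * (zeta ^ l * Q m mb n nb P) := fun j => by ring
  rw [F1_ap, e (k - 1), e k, key, ← e k, mul_assoc, const_pow_mul _ vE01_zeta,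
    const_pow_mul _ (vE_zetab _ _), vE01_Q _ _ _ _ _ (h.vE _ _), smul_smul]
  simp only [mul_smul_comm, mul_assoc]

lemma F2_term (k l m mb n nb : ℕ) (P : R12) (h : Kill P) :
    F2 (zeta ^ l * zetab ^ k * Q m mb n nb P) =
      (nb : ℂ) • (zeta ^ l * zetab ^ k * Q m (mb + 1) n (nb - 1) P) -
      (Complex.I * ((l : ℂ) * (l + 1 + (m + n)))) •
        (zeta ^ (l - 1) * zetab ^ k * Q m mb n nb P) := by
  have hb : boxY (zetab ^ k * Q m mb n nb P) = 0 := by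
    have := boxY_Q m mb n nb P h
    rw [boxY] at this ⊢
    simp only [const_pow_mul _ (py_zetab _ _)]
    rw [← mul_sub, this, mul_zero]
  have hd : (vE 0 0 + vE 1 1) (zetab ^ k * Q m mb n nb P) =
      ((m : ℂ) + n) • (zetab ^ k * Q m mb n nb P) := by
    rw [const_pow_mul _ (by simp [vE_zetab]), Derivation.add_apply,
      vE00_Q _ _ _ _ _ (h.vE _ _), vE11_Q _ _ _ _ _ (h.vE _ _), ← add_smul, mul_smul_comm]
  have hz : (vE 0 0 + vE 1 1) zeta = (2 : ℂ) • zeta := by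
    rw [Derivation.add_apply, vE_zeta, vE_zeta, ← add_smul]; norm_num
  have key := box_pow_mul boxY _ zeta boxY_mul_zeta hz _ _ hb hd l
  simp only [mul_assoc] at key ⊢
  rw [F2_ap, key, const_pow_mul _ (vEb_zeta _ _),
    const_pow_mul _ vEb01_zetab, vEb01_Q _ _ _ _ _ (h.vEb _ _), smul_smul]
  simp only [mul_smul_comm, mul_assoc]

lemma tele (b : ℕ) (c : ℕ → ℂ) (d : ℂ) (T S : ℕ → R12) (hS : ∀ k < b, S (k + 1) = T k)
    (hc : ∀ k < b, c k * ((b - k : ℕ) : ℂ) =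
      c (k + 1) * (Complex.I * (((k + 1 : ℕ) : ℂ) * ((k + 1 : ℕ) + 1 + d)))) :
    ∑ k ∈ Finset.range (b + 1), c k • (((b - k : ℕ) : ℂ) • T k -
      (Complex.I * ((k : ℂ) * (k + 1 + d))) • S k) = 0 := by
  simp only [smul_sub, smul_smul, Finset.sum_sub_distrib]
  rw [Finset.sum_range_succ, Finset.sum_range_succ' (fun k => (c k * _) • S k)]
  simp only [Nat.sub_self, Nat.cast_zero, mul_zero, zero_mul, zero_smul, add_zero]
  rw [sub_eq_zero]
  refine Finset.sum_congr rfl fun k hk => ?_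
  rw [Finset.mem_range] at hk
  rw [hS k hk, hc k hk]

lemma cMom_k (a b abar bbar k l : ℕ) (hk : k < b) :
    cMom a b abar bbar k l * ((b - k : ℕ) : ℂ) = cMom a b abar bbar (k + 1) l *
      (Complex.I * (((k + 1 : ℕ) : ℂ) * ((k + 1 : ℕ) + 1 + ((abar + bbar : ℕ) : ℂ)))) := by
  obtain ⟨j, rfl⟩ : ∃ j, b = k + 1 + j := ⟨b - (k + 1), by omega⟩
  have e1 : k + 1 + j - k = j + 1 := by omega
  have e2 : k + 1 + j - (k + 1) = j := by omega
  have e3 : abar + bbar + (k + 1) + 1 = (abar + bbar + k + 1) + 1 := by ring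
  have e4 : k + 1 + l = (k + l) + 1 := by ring
  rw [cMom, cMom, e1, e2, e3, e4, Nat.factorial_succ j, Nat.factorial_succ k,
    Nat.factorial_succ (abar + bbar + k + 1), pow_succ]
  have n1 : ((j : ℂ) + 1) ≠ 0 := by exact_mod_cast Nat.succ_ne_zero j
  have n2 : ((k : ℂ) + 1) ≠ 0 := by exact_mod_cast Nat.succ_ne_zero k
  have n3 : ((abar : ℂ) + bbar + k + 1 + 1) ≠ 0 := by
    exact_mod_cast Nat.succ_ne_zero (abar + bbar + k + 1)
  have nf : ∀ n : ℕ, (Nat.factorial n : ℂ) ≠ 0 := fun n => by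
    exact_mod_cast Nat.factorial_ne_zero n
  have f1 := nf j
  have f2 := nf k
  have f3 := nf l
  have f4 := nf (bbar - l)
  have f5 := nf (a + (k + 1 + j) + l + 1)
  have f6 := nf (abar + bbar + k + 1)
  have hI := Complex.I_ne_zero
  push_cast
  field_simp
  ring

lemma cMom_symm (a b abar bbar k l : ℕ) :
    cMom a b abar bbar k l = cMom abar bbar a b l k := by
  rw [cMom, cMom, add_comm k l]
  congr 1 <;> ring

lemma F1_Psi (a b abar bbar : ℕ) (P : R12) (h : Kill P) : F1 (Psi12 a b abar bbar P) = 0 := by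
  rw [Psi12, Finset.sum_comm, map_sum]
  refine Finset.sum_eq_zero fun l hl => ?_
  have hl' : l ≤ bbar := by simpa [Nat.lt_succ_iff] using hl
  rw [map_sum, ← tele b (fun k => cMom a b abar bbar k l) ((abar + bbar : ℕ) : ℂ)
    (fun k => zeta ^ l * zetab ^ k * Q (a + k + 1) (abar + l) (b - k - 1) (bbar - l) P)
    (fun k => zeta ^ l * zetab ^ (k - 1) * Q (a + k) (abar + l) (b - k) (bbar - l) P)
    (fun k hk => by simp only [Nat.add_sub_cancel, add_assoc, Nat.sub_sub])
    (fun k hk => cMom_k a b abar bbar k l hk)]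
  refine Finset.sum_congr rfl fun k hk => ?_
  rw [map_smul]
  congr 1
  refine (F1_term k l (a + k) (abar + l) (b - k) (bbar - l) P h).trans ?_
  have : ((abar + l : ℕ) : ℂ) + ((bbar - l : ℕ) : ℂ) = ((abar + bbar : ℕ) : ℂ) := by
    rw [← Nat.cast_add]; congr 1; omega
  rw [this]

lemma F2_Psi (a b abar bbar : ℕ) (P : R12) (h : Kill P) : F2 (Psi12 a b abar bbar P) = 0 := by
  rw [Psi12, map_sum]
  refine Finset.sum_eq_zero fun k hk => ?_
  have hk' : k ≤ b := by simpa [Nat.lt_succ_iff] using hk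
  rw [map_sum, ← tele bbar (fun l => cMom a b abar bbar k l) ((a + b : ℕ) : ℂ)
    (fun l => zeta ^ l * zetab ^ k * Q (a + k) (abar + l + 1) (b - k) (bbar - l - 1) P)
    (fun l => zeta ^ (l - 1) * zetab ^ k * Q (a + k) (abar + l) (b - k) (bbar - l) P)
    (fun l hl => by simp only [Nat.add_sub_cancel, add_assoc, Nat.sub_sub])
    (fun l hl => by
      simp only [cMom_symm a b]
      exact cMom_k abar bbar a b l k hl)]
  refine Finset.sum_congr rfl fun l hl => ?_
  rw [map_smul]
  congr 1
  refine (F2_term k l (a + k) (abar + l) (b - k) (bbar - l) P h).trans ?_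
  have : ((a + k : ℕ) : ℂ) + ((b - k : ℕ) : ℂ) = ((a + b : ℕ) : ℂ) := by
    rw [← Nat.cast_add]; congr 1; omega
  rw [this]

/-! ### The weights -/

lemma vE_term (i : Fin 2) (k l m mb n nb : ℕ) (P : R12) (h : Kill P) :
    vE i i (zeta ^ l * zetab ^ k * Q m mb n nb P) =
      ((l : ℂ) + (if i = 0 then (m : ℂ) else n)) • (zeta ^ l * zetab ^ k * Q m mb n nb P) := by
  have hz : vE i i zetab = (0 : ℂ) • zetab := by rw [vE_zetab, zero_smul]
  have hQ : vE i i (Q m mb n nb P) = (if i = 0 then (m : ℂ) else n) • Q m mb n nb P := by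
    fin_cases i
    · simpa using vE00_Q m mb n nb P (h.vE _ _)
    · simpa using vE11_Q m mb n nb P (h.vE _ _)
  rw [eig_mul _ (eig_mul _ (eig_pow _ (vE_zeta i) l) (eig_pow _ hz k)) hQ]
  simp

lemma vEb_term (i : Fin 2) (k l m mb n nb : ℕ) (P : R12) (h : Kill P) :
    vEb i i (zeta ^ l * zetab ^ k * Q m mb n nb P) =
      ((k : ℂ) + (if i = 0 then (mb : ℂ) else nb)) • (zeta ^ l * zetab ^ k * Q m mb n nb P) := by
  have hz : vEb i i zeta = (0 : ℂ) • zeta := by rw [vEb_zeta, zero_smul]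
  have hQ : vEb i i (Q m mb n nb P) = (if i = 0 then (mb : ℂ) else nb) • Q m mb n nb P := by
    fin_cases i
    · simpa using vEb00_Q m mb n nb P (h.vEb _ _)
    · simpa using vEb11_Q m mb n nb P (h.vEb _ _)
  rw [eig_mul _ (eig_mul _ (eig_pow _ hz l) (eig_pow _ (vEb_zetab i) k)) hQ]
  simp

lemma H1_ap (x : R12) :
    H1 x = vEb 0 0 x - vE 0 0 x + vE 1 1 x + vEb 1 1 x + (2 : ℂ) • x := by
  rw [H1]; simp only [sum_dy_eq, sum_dyb_eq]; rfl

lemma H2_ap (x : R12) :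
    H2 x = vE 0 0 x - vEb 0 0 x + vE 1 1 x + vEb 1 1 x + (2 : ℂ) • x := by
  rw [H2]; simp only [sum_dy_eq, sum_dyb_eq]; rfl

lemma eig_Psi (H : Module.End ℂ R12) (r : ℂ) (a b abar bbar : ℕ) (P : R12)
    (h : ∀ k ≤ b, ∀ l ≤ bbar, H (zeta ^ l * zetab ^ k * Q (a + k) (abar + l) (b - k) (bbar - l) P) =
      r • (zeta ^ l * zetab ^ k * Q (a + k) (abar + l) (b - k) (bbar - l) P)) :
    H (Psi12 a b abar bbar P) = r • Psi12 a b abar bbar P := by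
  rw [Psi12, map_sum, Finset.smul_sum]
  refine Finset.sum_congr rfl fun k hk => ?_
  rw [map_sum, Finset.smul_sum]
  refine Finset.sum_congr rfl fun l hl => ?_
  rw [map_smul, smul_comm]
  congr 1
  exact h k (by simpa [Nat.lt_succ_iff] using hk) l (by simpa [Nat.lt_succ_iff] using hl)

lemma H1_Psi (a b abar bbar : ℕ) (P : R12) (h : Kill P) :
    H1 (Psi12 a b abar bbar P) =
      (((abar : ℂ) - (a : ℂ) + (b : ℂ) + (bbar : ℂ) + 2)) • Psi12 a b abar bbar P := by
  refine eig_Psi _ _ _ _ _ _ _ fun k hk l hl => ?_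
  rw [H1_ap]
  simp only [vE_term _ _ _ _ _ _ _ _ h, vEb_term _ _ _ _ _ _ _ _ h, ← add_smul, ← sub_smul]
  congr 1
  push_cast [Nat.cast_sub hk, Nat.cast_sub hl]
  simp
  ring

lemma H2_Psi (a b abar bbar : ℕ) (P : R12) (h : Kill P) :
    H2 (Psi12 a b abar bbar P) =
      (((a : ℂ) - (abar : ℂ) + (b : ℂ) + (bbar : ℂ) + 2)) • Psi12 a b abar bbar P := by
  refine eig_Psi _ _ _ _ _ _ _ fun k hk l hl => ?_
  rw [H2_ap]
  simp only [vE_term _ _ _ _ _ _ _ _ h, vEb_term _ _ _ _ _ _ _ _ h, ← add_smul, ← sub_smul]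
  congr 1
  push_cast [Nat.cast_sub hk, Nat.cast_sub hl]
  simp
  ring

/-! ### Support -/

lemma wh_step (w : Idx12 → ℕ) (B : Module.End ℂ R12) (r : ℕ)
    (hB : ∀ n x, IsWeightedHomogeneous w x (n + r) → IsWeightedHomogeneous w (B x) n)
    (n m : ℕ) (x : R12) (hx : IsWeightedHomogeneous w x (n + m * r)) :
    IsWeightedHomogeneous w ((B ^ m) x) n := by
  induction m generalizing x with
  | zero => simpa using hx
  | succ m ih =>
    rw [pow_succ, Module.End.mul_apply]
    refine ih _ (hB _ _ ?_)
    convert hx using 1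
    ring

lemma vD_wt (w : Idx12 → ℕ) (i : Fin 2) (r : ℕ) (hw : ∀ j, w (Sum.inl j) = 0)
    (hr : ∀ p, w (Sum.inr (Sum.inl p)) = r) (n : ℕ) (x : R12)
    (hx : IsWeightedHomogeneous w x (n + r)) : IsWeightedHomogeneous w (vD i x) n := by
  have e : vD i x = ∑ p, yv i p * pu p x := by simp [vD]
  rw [e]
  refine IsWeightedHomogeneous.sum _ _ _ fun p _ => ?_
  have h1 : IsWeightedHomogeneous w (yv i p) 0 := by
    have := isWeightedHomogeneous_X ℂ w (Sum.inl (Sum.inl (i, p)))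
    rwa [hw] at this
  have h2 : IsWeightedHomogeneous w (pu p x) n := hx.pderiv (by rw [hr])
  simpa using h1.mul h2

lemma vDb_wt (w : Idx12 → ℕ) (i : Fin 2) (r : ℕ) (hw : ∀ j, w (Sum.inl j) = 0)
    (hr : ∀ p, w (Sum.inr (Sum.inr p)) = r) (n : ℕ) (x : R12)
    (hx : IsWeightedHomogeneous w x (n + r)) : IsWeightedHomogeneous w (vDb i x) n := by
  have e : vDb i x = ∑ p, ybv i p * pub p x := by simp [vDb]
  rw [e]
  refine IsWeightedHomogeneous.sum _ _ _ fun p _ => ?_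
  have h1 : IsWeightedHomogeneous w (ybv i p) 0 := by
    have := isWeightedHomogeneous_X ℂ w (Sum.inl (Sum.inr (i, p)))
    rwa [hw] at this
  have h2 : IsWeightedHomogeneous w (pub p x) n := hx.pderiv (by rw [hr])
  simpa using h1.mul h2

lemma Q_wt (w : Idx12 → ℕ) (r rb : ℕ) (hw : ∀ j, w (Sum.inl j) = 0)
    (hr : ∀ p, w (Sum.inr (Sum.inl p)) = r) (hrb : ∀ p, w (Sum.inr (Sum.inr p)) = rb)
    (m mb n nb : ℕ) (P : R12)
    (hP : IsWeightedHomogeneous w P (0 + m * r + mb * rb + n * r + nb * rb)) :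
    IsWeightedHomogeneous w (Q m mb n nb P) 0 := by
  refine wh_step w D1 r (fun n x hx => ?_) _ _ _ (wh_step w Db1 rb (fun n x hx => ?_) _ _ _
    (wh_step w D2 r (fun n x hx => ?_) _ _ _ (wh_step w Db2 rb (fun n x hx => ?_) _ _ _ hP)))
  · rw [D1_ap_s12]; exact vD_wt w _ r hw hr n x hx
  · rw [Db1_ap_s12]; exact vDb_wt w _ rb hw hrb n x hx
  · rw [D2_ap_s12]; exact vD_wt w _ r hw hr n x hx
  · rw [Db2_ap_s12]; exact vDb_wt w _ rb hw hrb n x hx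

lemma wt_zero_vars (w : Idx12 → ℕ) (x : R12) (hx : IsWeightedHomogeneous w x 0) (j : Idx12)
    (hj : j ∈ x.vars) : w j = 0 := by
  obtain ⟨d, hd, hjd⟩ := (mem_vars j).mp hj
  have h0 := hx (mem_support_iff.mp hd)
  rw [Finsupp.weight_apply, Finsupp.sum, Finset.sum_eq_zero_iff] at h0
  have := h0 j hjd
  rcases Nat.mul_eq_zero.mp (by simpa using this) with h | h
  · exact absurd h (Finsupp.mem_support_iff.mp hjd)
  · exact h

lemma Q_supp (m mb n nb : ℕ) (P : R12) (h1 : IsWeightedHomogeneous wtU P (m + n))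
    (h2 : IsWeightedHomogeneous wtUb P (mb + nb)) :
    Q m mb n nb P ∈ MvPolynomial.supported ℂ
      (Set.range (Sum.inl : (Fin 2 × Fin 2) ⊕ (Fin 2 × Fin 2) → Idx12)) := by
  rw [mem_supported]
  have w1 : IsWeightedHomogeneous wtU (Q m mb n nb P) 0 :=
    Q_wt wtU 1 0 (fun _ => by rfl) (fun _ => rfl) (fun _ => rfl) _ _ _ _ _ (by simpa using h1)
  have w2 : IsWeightedHomogeneous wtUb (Q m mb n nb P) 0 :=
    Q_wt wtUb 0 1 (fun _ => by rfl) (fun _ => rfl) (fun _ => rfl) _ _ _ _ _ (by simpa using h2)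
  intro j hj
  rcases j with j | (j | j)
  · exact ⟨j, rfl⟩
  · exact absurd (wt_zero_vars _ _ w1 _ hj) (by simp [wtU])
  · exact absurd (wt_zero_vars _ _ w2 _ hj) (by simp [wtUb])

lemma Psi_supp (a b abar bbar : ℕ) (P : R12) (h1 : IsWeightedHomogeneous wtU P (a + b))
    (h2 : IsWeightedHomogeneous wtUb P (abar + bbar)) :
    Psi12 a b abar bbar P ∈ MvPolynomial.supported ℂ
      (Set.range (Sum.inl : (Fin 2 × Fin 2) ⊕ (Fin 2 × Fin 2) → Idx12)) := by
  have hy : ∀ i p, yv i p ∈ MvPolynomial.supported ℂ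
      (Set.range (Sum.inl : (Fin 2 × Fin 2) ⊕ (Fin 2 × Fin 2) → Idx12)) :=
    fun i p => X_mem_supported.mpr ⟨_, rfl⟩
  have hyb : ∀ i p, ybv i p ∈ MvPolynomial.supported ℂ
      (Set.range (Sum.inl : (Fin 2 × Fin 2) ⊕ (Fin 2 × Fin 2) → Idx12)) :=
    fun i p => X_mem_supported.mpr ⟨_, rfl⟩
  refine Subalgebra.sum_mem _ fun k hk => Subalgebra.sum_mem _ fun l hl => ?_
  have hk' : k ≤ b := by simpa [Nat.lt_succ_iff] using hk
  have hl' : l ≤ bbar := by simpa [Nat.lt_succ_iff] using hl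
  refine Subalgebra.smul_mem _ (Subalgebra.mul_mem _ (Subalgebra.mul_mem _
    (Subalgebra.pow_mem _ ?_ _) (Subalgebra.pow_mem _ ?_ _)) (Q_supp _ _ _ _ _ ?_ ?_)) _
  · exact Subalgebra.sub_mem _ (Subalgebra.mul_mem _ (hy _ _) (hy _ _))
      (Subalgebra.mul_mem _ (hy _ _) (hy _ _))
  · exact Subalgebra.sub_mem _ (Subalgebra.mul_mem _ (hyb _ _) (hyb _ _))
      (Subalgebra.mul_mem _ (hyb _ _) (hyb _ _))
  · convert h1 using 1; omega
  · convert h2 using 1; omega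

lemma Kill_of_supp (P : R12)
    (h : P ∈ MvPolynomial.supported ℂ (Set.range (Sum.inr : Fin 2 ⊕ Fin 2 → Idx12))) :
    Kill P := by
  intro j
  refine pderiv_eq_zero_of_notMem_vars fun hj => ?_
  obtain ⟨i, hi⟩ := mem_supported.mp h hj
  cases hi

theorem stmt12 (a b abar bbar : ℕ) (P : R12) (hP : BihomW (a + b) (abar + bbar) P) :
    Psi12 a b abar bbar P ∈ MvPolynomial.supported ℂ (Set.range Sum.inl) ∧
    F1 (Psi12 a b abar bbar P) = 0 ∧
    F2 (Psi12 a b abar bbar P) = 0 ∧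
    H1 (Psi12 a b abar bbar P) =
      (((abar : ℂ) - (a : ℂ) + (b : ℂ) + (bbar : ℂ) + 2)) • Psi12 a b abar bbar P ∧
    H2 (Psi12 a b abar bbar P) =
      (((a : ℂ) - (abar : ℂ) + (b : ℂ) + (bbar : ℂ) + 2)) • Psi12 a b abar bbar P := by
  have h := Kill_of_supp P hP.1
  exact ⟨Psi_supp _ _ _ _ _ hP.2.1 hP.2.2, F1_Psi _ _ _ _ _ h, F2_Psi _ _ _ _ _ h,
    H1_Psi _ _ _ _ _ h, H2_Psi _ _ _ _ _ h⟩

end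
end
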